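/- Let τ be in the complex upper half-plane, set q = e^{2πiτ}, and let u ∈ ℂ with u ∉ 2ℤτ + ℤ, z = e^{2πiu}. Then 2 z ( (q²;q²)_∞² / (−q;q²)_∞ ) C*(z;q²)³ (−zq;q²)_∞ (−z^{−1}q;q²)_∞ = ( 2δ_q + δ_z + δ_z² ) N*(0,1/q,z;q²), where δ_q := (2πi)^{−1}∂/∂τ and δ_z := (2πi)^{−1}∂/∂u act on (u,τ) ↦ N*(0,1/q,e^{2πiu}; e^{4πiτ}). -/

import Mathlib

open Complex Real Filter

noncomputable section

/-- The Jacobi theta function ϑ(u;τ) = Σ_{ν∈ℤ+1/2} e^{πiν²τ + 2πiν(u+1/2)}. -/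
def jTheta (u τ : ℂ) : ℂ :=
  ∑' n : ℤ, Complex.exp (π * I * ((n : ℂ) + 1/2)^2 * τ + 2 * π * I * ((n : ℂ) + 1/2) * (u + 1/2))

/-- ϑ₀(u;τ) = Σ_{n∈ℤ} e^{πin²τ + 2πinu}. -/
def jTheta0 (u τ : ℂ) : ℂ :=
  ∑' n : ℤ, Complex.exp (π * I * (n : ℂ)^2 * τ + 2 * π * I * (n : ℂ) * u)

/-- ϑ₁(u;τ) = Σ_{n∈1/2+ℤ} e^{πin²τ + 2πinu}. -/
def jTheta1 (u τ : ℂ) : ℂ :=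
  ∑' n : ℤ, Complex.exp (π * I * ((n : ℂ) + 1/2)^2 * τ + 2 * π * I * ((n : ℂ) + 1/2) * u)

/-- The Dedekind eta function. -/
def dedekindEta (τ : ℂ) : ℂ :=
  Complex.exp (π * I * τ / 12) * ∏' n : ℕ, (1 - Complex.exp (2 * π * I * ((n : ℂ) + 1) * τ))

/-- The Lerch sum μ(u,v;τ). -/
def lerchMu (u v τ : ℂ) : ℂ :=
  Complex.exp (π * I * u) / jTheta v τ *
    ∑' n : ℤ, (-1 : ℂ) ^ n * Complex.exp (π * I * ((n : ℂ)^2 + (n : ℂ)) * τ + 2 * π * I * v * (n : ℂ)) /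
      (1 - Complex.exp (2 * π * I * (n : ℂ) * τ + 2 * π * I * u))

/-- a₀^{α,β}(τ). -/
def aCoef0 (α β : ℝ) (τ : ℂ) : ℂ :=
  ∑' n : ℤ, ((n : ℂ) + (α : ℂ)/2) *
    Complex.exp (2 * π * I * (n : ℂ)^2 * τ + 2 * π * I * (n : ℂ) * ((α : ℂ) * τ + (β : ℂ)))

/-- a₁^{α,β}(τ). -/
def aCoef1 (α β : ℝ) (τ : ℂ) : ℂ :=
  ∑' n : ℤ, (((n : ℂ) + 1/2) + (α : ℂ)/2) *
    Complex.exp (2 * π * I * ((n : ℂ) + 1/2)^2 * τ + 2 * π * I * ((n : ℂ) + 1/2) * ((α : ℂ) * τ + (β : ℂ)))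

/-- Finite q-Pochhammer symbol (a;q)_n. -/
def qPochN (a q : ℂ) (n : ℕ) : ℂ := ∏ j ∈ Finset.range n, (1 - a * q ^ j)

/-- Infinite q-Pochhammer symbol (a;q)_∞. -/
def qPochInf (a q : ℂ) : ℂ := ∏' j : ℕ, (1 - a * q ^ j)

/-- The modified rank generating function R*(z;q). -/
def rankStar (z q : ℂ) : ℂ :=
  (qPochInf q q)⁻¹ * ∑' n : ℤ, (-1 : ℂ) ^ n * q ^ (n * (3 * n + 1) / 2) / (1 - z * q ^ n)

/-- The modified crank generating function C*(z;q). -/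
def crankStar (z q : ℂ) : ℂ :=
  (1 - z)⁻¹ * ∏' n : ℕ, ((1 - q ^ (n + 1)) / ((1 - z * q ^ (n + 1)) * (1 - z⁻¹ * q ^ (n + 1))))

/-- N(1,0,z;q), the overpartition-rank generating function. -/
def nGen10 (z q : ℂ) : ℂ :=
  ∑' n : ℕ, qPochN (-1) q n * q ^ (n * (n + 1) / 2) / (qPochN (z * q) q n * qPochN (z⁻¹ * q) q n)

/-- N*(1,0,z;q). -/
def nStar10 (z q : ℂ) : ℂ := nGen10 z q / (1 - z)

/-- N(1,1/q,z;q²), the M2-rank generating function for overpartitions. -/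
def nGenM2over (z q : ℂ) : ℂ :=
  ∑' n : ℕ, qPochN (-1) (q^2) n * qPochN (-q) (q^2) n * q ^ n /
    (qPochN (z * q^2) (q^2) n * qPochN (z⁻¹ * q^2) (q^2) n)

/-- N*(1,1/q,z;q²). -/
def nStarM2over (z q : ℂ) : ℂ := nGenM2over z q / (1 - z)

/-- N(0,1/q,z;q²), the M2-rank generating function for partitions without repeated odd parts. -/
def nGenM2 (z q : ℂ) : ℂ :=
  ∑' n : ℕ, qPochN (-q) (q^2) n * q ^ (n^2) /
    (qPochN (z * q^2) (q^2) n * qPochN (z⁻¹ * q^2) (q^2) n)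

/-- N*(0,1/q,z;q²). -/
def nStarM2 (z q : ℂ) : ℂ := nGenM2 z q / (1 - z)

/-- The odd-rank generating function R^o(z;q). -/
def oddRank (z q : ℂ) : ℂ :=
  (qPochInf (q^2) (q^2))⁻¹ * ∑' n : ℤ, (-1 : ℂ) ^ n * q ^ (3 * n^2 + 3 * n + 1) / (1 - z * q ^ (2 * n + 1))

open scoped Topology

lemma qPochN_succ (a q : ℂ) (n : ℕ) :
    qPochN a q (n + 1) = qPochN a q n * (1 - a * q ^ n) :=
  Finset.prod_range_succ _ _

lemma summable_norm_mul_pow (a : ℂ) {q : ℂ} (hq : ‖q‖ < 1) :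
    Summable fun j : ℕ => ‖-(a * q ^ j)‖ := by
  simpa using (summable_geometric_of_lt_one (norm_nonneg _) hq).mul_left ‖a‖

lemma multipliable_qPochInf (a : ℂ) {q : ℂ} (hq : ‖q‖ < 1) :
    Multipliable fun j : ℕ => 1 - a * q ^ j := by
  simpa [sub_eq_add_neg] using multipliable_one_add_of_summable (summable_norm_mul_pow a hq)

lemma tendsto_qPochN (a : ℂ) {q : ℂ} (hq : ‖q‖ < 1) :
    Tendsto (qPochN a q) atTop (𝓝 (qPochInf a q)) :=
  (multipliable_qPochInf a hq).hasProd.tendsto_prod_nat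

lemma qPochInf_ne_zero {a q : ℂ} (hq : ‖q‖ < 1) (h : ∀ j : ℕ, 1 - a * q ^ j ≠ 0) :
    qPochInf a q ≠ 0 := by
  have := tprod_one_add_ne_zero_of_summable (f := fun j : ℕ => -(a * q ^ j))
    (fun j => by simpa [sub_eq_add_neg] using h j) (summable_norm_mul_pow a hq)
  simpa [qPochInf, sub_eq_add_neg] using this

lemma qPochInf_eq_mul (a : ℂ) {q : ℂ} (hq : ‖q‖ < 1) :
    qPochInf a q = (1 - a) * qPochInf (a * q) q := by
  rw [qPochInf, tprod_eq_zero_mul']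
  · simp [qPochInf, pow_succ', mul_assoc]
  · simpa [pow_succ', mul_assoc] using multipliable_qPochInf (a * q) hq

lemma differentiable_qPochInf {q : ℂ} (hq : ‖q‖ < 1) :
    Differentiable ℂ fun a => qPochInf a q := by
  have h : MultipliableLocallyUniformlyOn (fun (j : ℕ) (a : ℂ) => 1 - a * q ^ j) Set.univ := by
    use fun a => ∏' j : ℕ, (1 - a * q ^ j)
    simp_rw [sub_eq_add_neg]
    apply hasProdLocallyUniformlyOn_of_forall_compact isOpen_univ
    intro K _ hcK
    obtain ⟨C, hC⟩ := hcK.isBounded.exists_norm_le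
    refine ((summable_geometric_of_lt_one (norm_nonneg _) hq).mul_left C).hasProdUniformlyOn_nat_one_add
      hcK (.of_forall fun n x hx => ?_) (fun _ => by fun_prop)
    simpa using mul_le_mul_of_nonneg_right (hC x hx) (by positivity)
  rw [← differentiableOn_univ]
  exact h.hasProdLocallyUniformlyOn.differentiableOn
    (.of_forall fun _ => by simpa [Finset.prod_fn] using
      DifferentiableOn.finsetProd (fun _ _ => by fun_prop)) isOpen_univ

lemma one_sub_mul_pow_ne_zero {a q : ℂ} (ha : ‖a‖ < 1) (hq : ‖q‖ < 1) (j : ℕ) :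
    1 - a * q ^ j ≠ 0 := by
  intro h
  have h1 : ‖a * q ^ j‖ = 1 := by rw [← sub_eq_zero.1 h, norm_one]
  rw [norm_mul, norm_pow] at h1
  have := pow_le_one₀ (norm_nonneg q) hq.le (n := j)
  nlinarith [norm_nonneg a, pow_nonneg (norm_nonneg q) j]

/-- The reciprocal `1/(Q;Q)_m`, extended by zero to negative `m`. -/
def recipQPoch (Q : ℂ) (m : ℤ) : ℂ := if m < 0 then 0 else (qPochN Q Q m.toNat)⁻¹

lemma recipQPoch_of_neg (Q : ℂ) {m : ℤ} (hm : m < 0) : recipQPoch Q m = 0 := if_pos hm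

lemma recipQPoch_natCast (Q : ℂ) (m : ℕ) : recipQPoch Q m = (qPochN Q Q m)⁻¹ := by
  simp [recipQPoch]

lemma recipQPoch_sub_one {Q : ℂ} (hQ : ‖Q‖ < 1) (m : ℤ) :
    recipQPoch Q (m - 1) = recipQPoch Q m * (1 - Q ^ m) := by
  rcases lt_trichotomy m 0 with h | rfl | h
  · rw [recipQPoch_of_neg Q h, recipQPoch_of_neg Q (by omega), zero_mul]
  · simp [recipQPoch_of_neg]
  · obtain ⟨k, rfl⟩ : ∃ k : ℕ, m = (k + 1 : ℕ) := ⟨(m - 1).toNat, by omega⟩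
    rw [show ((k + 1 : ℕ) : ℤ) - 1 = k by push_cast; ring, recipQPoch_natCast, recipQPoch_natCast,
      qPochN_succ, zpow_natCast, pow_succ' Q k]
    have := one_sub_mul_pow_ne_zero hQ hQ k
    field_simp

lemma exists_bound_qPochN (a : ℂ) {q : ℂ} (hq : ‖q‖ < 1) : ∃ C, ∀ n, ‖qPochN a q n‖ ≤ C := by
  obtain ⟨C, hC⟩ := (tendsto_qPochN a hq).norm.bddAbove_range
  exact ⟨C, fun n => hC ⟨n, rfl⟩⟩

lemma tendsto_recipQPoch {Q : ℂ} (hQ : ‖Q‖ < 1) :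
    Tendsto (fun m : ℕ => recipQPoch Q m) atTop (𝓝 (qPochInf Q Q)⁻¹) := by
  simp_rw [recipQPoch_natCast]
  exact (tendsto_qPochN Q hQ).inv₀ (qPochInf_ne_zero hQ (one_sub_mul_pow_ne_zero hQ hQ))

lemma exists_bound_recipQPoch {Q : ℂ} (hQ : ‖Q‖ < 1) : ∃ C, ∀ m, ‖recipQPoch Q m‖ ≤ C := by
  obtain ⟨C, hC⟩ := (tendsto_recipQPoch hQ).norm.bddAbove_range
  refine ⟨C, fun m => ?_⟩
  have hC0 : 0 ≤ C := (norm_nonneg _).trans (hC ⟨0, rfl⟩)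
  rcases lt_or_ge m 0 with h | h
  · simpa [recipQPoch_of_neg Q h]
  · lift m to ℕ using h
    exact hC ⟨m, rfl⟩

lemma summable_mul_recipQPoch (Q : ℂ) (n : ℤ) (h : ℤ → ℂ) :
    Summable fun r : ℤ => h r * (recipQPoch Q (n - r) * recipQPoch Q (n + r)) := by
  refine summable_of_hasFiniteSupport ((Set.finite_Icc (-n) n).subset fun r hr => ?_)
  by_contra hc
  rw [Set.mem_Icc, not_and_or] at hc
  refine hr ?_
  rcases hc with hc | hc
  · simp [recipQPoch_of_neg Q (show n + r < 0 by omega)]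
  · simp [recipQPoch_of_neg Q (show n - r < 0 by omega)]

lemma norm_sq_lt_one {q : ℂ} (hq : ‖q‖ < 1) : ‖q ^ 2‖ < 1 := by
  rw [norm_pow]
  exact pow_lt_one₀ (norm_nonneg q) hq two_ne_zero

lemma one_sub_sq_zpow_natCast_ne_zero {q : ℂ} (hq : ‖q‖ < 1) {n : ℕ} (hn : n ≠ 0) :
    1 - (q ^ 2) ^ (n : ℤ) ≠ 0 := by
  obtain ⟨k, rfl⟩ := Nat.exists_eq_succ_of_ne_zero hn
  rw [zpow_natCast, pow_succ']
  exact one_sub_mul_pow_ne_zero (norm_sq_lt_one hq) (norm_sq_lt_one hq) k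

/-- The coefficients of the partial fraction expansion of `1 / ((1 - z) (zq²;q²)_n (z⁻¹q²;q²)_n)`. -/
def fracCoef (q : ℂ) (n r : ℤ) : ℂ :=
  (-1) ^ r * q ^ (r * (r + 1)) * (recipQPoch (q ^ 2) (n - r) * recipQPoch (q ^ 2) (n + r))

lemma summable_fracCoef_mul (q : ℂ) (n : ℤ) (h : ℤ → ℂ) :
    Summable fun r => fracCoef q n r * h r := by
  refine (summable_mul_recipQPoch (q ^ 2) n fun r => (-1) ^ r * q ^ (r * (r + 1)) * h r).congr ?_
  intro r
  simp only [fracCoef]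
  ring

lemma summable_fracCoef (q : ℂ) (n : ℤ) : Summable (fracCoef q n) := by
  simpa using summable_fracCoef_mul q n 1

lemma fracCoef_neg {q : ℂ} (hq0 : q ≠ 0) (n r : ℤ) :
    fracCoef q n (-r) = fracCoef q n r * ((q ^ 2) ^ r)⁻¹ := by
  have h : q ^ (-r * (-r + 1)) = q ^ (r * (r + 1)) * ((q ^ 2) ^ r)⁻¹ := by
    rw [← zpow_natCast, ← zpow_mul, ← zpow_neg, ← zpow_add₀ hq0]
    congr 1
    push_cast
    ring
  simp only [fracCoef, h, sub_neg_eq_add, ← sub_eq_add_neg, zpow_neg, ← inv_zpow, inv_neg, inv_one]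
  ring

lemma tsum_fracCoef_mul_inv {q : ℂ} (hq0 : q ≠ 0) (n : ℤ) :
    ∑' r, fracCoef q n r * ((q ^ 2) ^ r)⁻¹ = ∑' r, fracCoef q n r := by
  rw [← (Equiv.neg ℤ).tsum_eq (fracCoef q n)]
  exact tsum_congr fun r => (fracCoef_neg hq0 n r).symm

lemma tsum_fracCoef_eq_zero {q : ℂ} (hq0 : q ≠ 0) (hq : ‖q‖ < 1) {n : ℕ} (hn : n ≠ 0) :
    ∑' r, fracCoef q n r = 0 := by
  have hQ := norm_sq_lt_one hq
  have hQ0 : q ^ 2 ≠ 0 := pow_ne_zero 2 hq0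
  set g : ℤ → ℂ := fun r => fracCoef q n r * (((q ^ 2) ^ r)⁻¹ * (1 - (q ^ 2) ^ (n + r))) with hg
  have hstep : ∀ r, g (r + 1) = -(fracCoef q n r * (1 - (q ^ 2) ^ (n - r))) := by
    intro r
    have h1 := recipQPoch_sub_one hQ (n - r)
    have h2 := recipQPoch_sub_one hQ (n + (r + 1))
    rw [show (n : ℤ) + (r + 1) - 1 = n + r by ring] at h2
    have h3 : q ^ ((r + 1) * (r + 1 + 1)) * ((q ^ 2) ^ (r + 1))⁻¹ = q ^ (r * (r + 1)) := by
      rw [← zpow_natCast, ← zpow_mul, ← zpow_neg, ← zpow_add₀ hq0]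
      congr 1
      push_cast
      ring
    have h4 : (-1 : ℂ) ^ (r + 1) = -(-1) ^ r := by
      rw [zpow_add₀ (by norm_num), zpow_one]; ring
    simp only [hg, fracCoef, h4, h2, show (n : ℤ) - (r + 1) = n - r - 1 by ring, h1]
    rw [← h3]
    ring
  have hsum : ∑' r, g (r + 1) = ∑' r, g r := (Equiv.addRight (1 : ℤ)).tsum_eq g
  have hg' : Summable g := summable_fracCoef_mul q n _
  have hg1 : Summable fun r => g (r + 1) := hg'.comp_injective (add_left_injective 1)
  have hdiff : ∀ r, g r - g (r + 1) =
      (1 - (q ^ 2) ^ (n : ℤ)) * (fracCoef q n r * ((q ^ 2) ^ r)⁻¹ + fracCoef q n r) := by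
    intro r
    rw [hstep]
    simp only [hg, zpow_add₀ hQ0, zpow_sub₀ hQ0]
    have := zpow_ne_zero r hQ0
    field_simp
    ring
  have h0 : ∑' r, (g r - g (r + 1)) = 0 := by
    rw [hg'.tsum_sub hg1, hsum, sub_self]
  rw [tsum_congr hdiff, tsum_mul_left, Summable.tsum_add (summable_fracCoef_mul q n _)
    (summable_fracCoef q n), tsum_fracCoef_mul_inv hq0] at h0
  have h1 := (mul_eq_zero.1 h0).resolve_left (one_sub_sq_zpow_natCast_ne_zero hq hn)
  linear_combination h1 / 2

lemma fracCoef_zero (q : ℂ) (r : ℤ) : fracCoef q 0 r = if r = 0 then 1 else 0 := by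
  split_ifs with h
  · subst h
    simp [fracCoef, recipQPoch, qPochN]
  · rcases lt_or_gt_of_ne h with h | h
    · simp [fracCoef, recipQPoch_of_neg _ h]
    · simp [fracCoef, recipQPoch_of_neg _ (show -r < 0 by omega)]

lemma fracCoef_sub_one {q : ℂ} (hq : ‖q‖ < 1) (n r : ℤ) : fracCoef q (n - 1) r =
    fracCoef q n r * ((1 - (q ^ 2) ^ (n - r)) * (1 - (q ^ 2) ^ (n + r))) := by
  have hQ := norm_sq_lt_one hq
  simp only [fracCoef, show n - 1 - r = n - r - 1 by ring, show n - 1 + r = n + r - 1 by ring,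
    recipQPoch_sub_one hQ]
  ring

theorem tsum_fracCoef_div {q z : ℂ} (hq0 : q ≠ 0) (hq : ‖q‖ < 1) (hz0 : z ≠ 0)
    (hz : ∀ r : ℤ, 1 - z * (q ^ 2) ^ r ≠ 0) (n : ℕ) :
    ∑' r, fracCoef q n r * (1 - z * (q ^ 2) ^ r)⁻¹ =
      (qPochN (z * q ^ 2) (q ^ 2) n * qPochN (z⁻¹ * q ^ 2) (q ^ 2) n)⁻¹ / (1 - z) := by
  have hQ0 : q ^ 2 ≠ 0 := pow_ne_zero 2 hq0
  induction n with
  | zero =>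
    rw [tsum_eq_single 0 fun r hr => by simp [fracCoef_zero, hr]]
    simp [fracCoef_zero, qPochN]
  | succ n ih =>
    set A : ℂ := 1 - z * (q ^ 2) ^ (n + 1) with hA
    set B : ℂ := 1 - z⁻¹ * (q ^ 2) ^ (n + 1) with hB
    have hA0 : A ≠ 0 := by simpa [zpow_natCast] using mod_cast hz (n + 1)
    have hB0 : B ≠ 0 := by
      have h1 := hz (-(n + 1 : ℕ))
      rw [zpow_neg, zpow_natCast] at h1
      intro h
      apply h1
      have h2 : (q ^ 2) ^ (n + 1) = z := by
        field_simp at hB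
        rw [h] at hB
        linear_combination hB
      rw [h2, mul_inv_cancel₀ hz0, sub_self]
    have hrec : ∑' r, fracCoef q (n + 1 : ℕ) r * (1 - z * (q ^ 2) ^ r)⁻¹ * (A * B) =
        ∑' r, fracCoef q n r * (1 - z * (q ^ 2) ^ r)⁻¹ := by
      have hpt : ∀ r, fracCoef q (n + 1 : ℕ) r * (1 - z * (q ^ 2) ^ r)⁻¹ * (A * B) =
          fracCoef q n r * (1 - z * (q ^ 2) ^ r)⁻¹ +
            (q ^ 2) ^ (n + 1) * (fracCoef q (n + 1 : ℕ) r * ((q ^ 2) ^ r)⁻¹ -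
              z⁻¹ * fracCoef q (n + 1 : ℕ) r) := by
        intro r
        have h1 := fracCoef_sub_one hq (n + 1 : ℕ) r
        rw [show ((n + 1 : ℕ) : ℤ) - 1 = n by push_cast; ring] at h1
        rw [h1, hA, hB, zpow_add₀ hQ0, zpow_sub₀ hQ0, zpow_natCast]
        have h2 := hz r
        have h3 := zpow_ne_zero r hQ0
        field_simp
        ring
      rw [tsum_congr hpt, Summable.tsum_add (summable_fracCoef_mul q n _)
        ((((summable_fracCoef_mul q _ _).sub ((summable_fracCoef q _).mul_left _))).mul_left _),
        tsum_mul_left, Summable.tsum_sub (summable_fracCoef_mul q _ _)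
        ((summable_fracCoef q _).mul_left _), tsum_mul_left, tsum_fracCoef_mul_inv hq0,
        tsum_fracCoef_eq_zero hq0 hq n.succ_ne_zero]
      ring
    rw [tsum_mul_right, ih] at hrec
    rw [eq_div_of_mul_eq (mul_ne_zero hA0 hB0) hrec, qPochN_succ, qPochN_succ, hA, hB]
    rw [show z * q ^ 2 * (q ^ 2) ^ n = z * (q ^ 2) ^ (n + 1) by ring,
      show z⁻¹ * q ^ 2 * (q ^ 2) ^ n = z⁻¹ * (q ^ 2) ^ (n + 1) by ring]
    simp only [mul_inv, div_eq_mul_inv]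
    ring

/-- The weights `(-q;q²)_n q^{n²}`. -/
def pochWeight (q : ℂ) (n : ℕ) : ℂ := qPochN (-q) (q ^ 2) n * q ^ n ^ 2

lemma pochWeight_succ (q : ℂ) (n : ℕ) :
    pochWeight q (n + 1) = pochWeight q n * ((1 + q * (q ^ n) ^ 2) * (q * (q ^ n) ^ 2)) := by
  rw [pochWeight, pochWeight, qPochN_succ]
  ring

lemma exists_bound_pochWeight {q : ℂ} (hq : ‖q‖ < 1) :
    ∃ C, 0 ≤ C ∧ ∀ n, ‖pochWeight q n‖ ≤ C * ‖q‖ ^ n := by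
  obtain ⟨C, hC⟩ := exists_bound_qPochN (-q) (norm_sq_lt_one hq)
  have hC0 : 0 ≤ C := (norm_nonneg _).trans (hC 0)
  refine ⟨C, hC0, fun n => ?_⟩
  rw [pochWeight, norm_mul, norm_pow]
  exact mul_le_mul (hC n) (pow_le_pow_of_le_one (norm_nonneg q) hq.le (Nat.le_self_pow two_ne_zero n))
    (by positivity) hC0

lemma summable_pochWeight_mul {q : ℂ} (hq : ‖q‖ < 1) {h : ℕ → ℂ} {K : ℝ} (hK : ∀ n, ‖h n‖ ≤ K) :
    Summable fun n => pochWeight q n * h n := by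
  obtain ⟨C, hC0, hC⟩ := exists_bound_pochWeight hq
  refine Summable.of_norm_bounded (((summable_geometric_of_lt_one (norm_nonneg q) hq).mul_left C).mul_right K)
    fun n => ?_
  rw [norm_mul]
  exact mul_le_mul (hC n) (hK n) (norm_nonneg _) (by positivity)

/-- The normalised sum `∑ (-q;q²)_n q^{n² - r²} / ((q²;q²)_{n-r} (q²;q²)_{n+r})`. -/
def qGaussSum (q : ℂ) (r : ℤ) : ℂ :=
  (q ^ (r * r))⁻¹ * ∑' n : ℕ, pochWeight q n *
    (recipQPoch (q ^ 2) (n - r) * recipQPoch (q ^ 2) (n + r))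

lemma summable_qGaussSum {q : ℂ} (hq : ‖q‖ < 1) (r s : ℤ) : Summable fun n : ℕ =>
    pochWeight q n * (recipQPoch (q ^ 2) (n - r) * recipQPoch (q ^ 2) (n + s)) := by
  obtain ⟨C, hC⟩ := exists_bound_recipQPoch (norm_sq_lt_one hq)
  refine summable_pochWeight_mul hq (K := C * C) fun n => ?_
  rw [norm_mul]
  exact mul_le_mul (hC _) (hC _) (norm_nonneg _) ((norm_nonneg _).trans (hC 0))

lemma qGaussSum_add_one {q : ℂ} (hq0 : q ≠ 0) (hq : ‖q‖ < 1) (r : ℤ) :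
    qGaussSum q (r + 1) = qGaussSum q r := by
  have hQ := norm_sq_lt_one hq
  have hQ0 : q ^ 2 ≠ 0 := pow_ne_zero 2 hq0
  set U : ℕ → ℂ := fun n => -((q ^ (r * r))⁻¹ * (1 - (q * (q ^ r) ^ 2)⁻¹)) *
    (pochWeight q n * (recipQPoch (q ^ 2) (n - (r + 1)) * recipQPoch (q ^ 2) (n + r))) with hU
  have hUs : Summable U := (summable_qGaussSum hq (r + 1) r).mul_left _
  have hU0 : U 0 = 0 := by
    rcases lt_or_ge r 0 with h | h
    · simp [hU, recipQPoch_of_neg _ h]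
    · simp [hU, recipQPoch_of_neg (q ^ 2) (show -1 + -r < 0 by omega)]
  have htel : ∑' n, (U (n + 1) - U n) = 0 := by
    rw [Summable.tsum_sub ((summable_nat_add_iff 1).2 hUs) hUs, hUs.tsum_eq_zero_add, hU0]
    ring
  have hpt : ∀ n, U (n + 1) - U n = (q ^ (r * r))⁻¹ * (pochWeight q n *
        (recipQPoch (q ^ 2) (n - r) * recipQPoch (q ^ 2) (n + r))) -
      (q ^ ((r + 1) * (r + 1)))⁻¹ * (pochWeight q n *
        (recipQPoch (q ^ 2) (n - (r + 1)) * recipQPoch (q ^ 2) (n + (r + 1)))) := by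
    intro n
    have h1 := recipQPoch_sub_one hQ (n - r)
    have h2 := recipQPoch_sub_one hQ (n + (r + 1))
    rw [show (n : ℤ) - r - 1 = n - (r + 1) by ring] at h1
    rw [show (n : ℤ) + (r + 1) - 1 = n + r by ring] at h2
    have h3 : q ^ ((r + 1) * (r + 1)) = q ^ (r * r) * (q * (q ^ r) ^ 2) := by
      rw [show (r + 1) * (r + 1) = r * r + (1 + (r + r)) by ring, zpow_add₀ hq0, zpow_add₀ hq0,
        zpow_add₀ hq0, zpow_one]
      ring
    have h4 : (q ^ 2) ^ ((n : ℤ) - r) = (q ^ n) ^ 2 / (q ^ r) ^ 2 := by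
      rw [zpow_sub₀ hQ0, zpow_natCast, ← zpow_natCast q 2, ← zpow_mul, mul_comm, zpow_mul,
        zpow_natCast, zpow_natCast]
      ring
    have h5 : (q ^ 2) ^ ((n : ℤ) + (r + 1)) = (q ^ n) ^ 2 * (q ^ r) ^ 2 * q ^ 2 := by
      rw [zpow_add₀ hQ0, zpow_add₀ hQ0, zpow_natCast, ← zpow_natCast q 2, ← zpow_mul,
        mul_comm _ r, zpow_mul, zpow_natCast, zpow_natCast, zpow_one]
      ring
    simp only [hU, Nat.cast_add, Nat.cast_one, show (n : ℤ) + 1 - (r + 1) = n - r by ring,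
      show (n : ℤ) + 1 + r = n + (r + 1) by ring, pochWeight_succ, h1, h2, h3, h4, h5]
    have h6 := zpow_ne_zero r hq0
    have h7 := zpow_ne_zero (r * r) hq0
    field_simp
    ring
  rw [tsum_congr hpt, Summable.tsum_sub ((summable_qGaussSum hq r r).mul_left _)
    ((summable_qGaussSum hq (r + 1) (r + 1)).mul_left _), tsum_mul_left, tsum_mul_left] at htel
  rw [qGaussSum, qGaussSum]
  linear_combination -htel

lemma qGaussSum_eq_zero {q : ℂ} (hq0 : q ≠ 0) (hq : ‖q‖ < 1) (r : ℤ) :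
    qGaussSum q r = qGaussSum q 0 := by
  induction r using Int.induction_on with
  | zero => rfl
  | succ i ih => rw [qGaussSum_add_one hq0 hq, ih]
  | pred i ih => rw [← ih, ← qGaussSum_add_one hq0 hq, sub_add_cancel]

lemma qGaussSum_natCast {q : ℂ} (hq0 : q ≠ 0) (hq : ‖q‖ < 1) (r : ℕ) :
    qGaussSum q r = ∑' k : ℕ, qPochN (-q) (q ^ 2) (k + r) * q ^ (k ^ 2 + 2 * k * r) *
      (recipQPoch (q ^ 2) k * recipQPoch (q ^ 2) ((k + 2 * r : ℕ) : ℤ)) := by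
  rw [qGaussSum, ← (summable_qGaussSum hq r r).sum_add_tsum_nat_add r, Finset.sum_eq_zero, zero_add,
    ← tsum_mul_left]
  · refine tsum_congr fun k => ?_
    rw [show ((k + r : ℕ) : ℤ) - r = k by push_cast; ring,
      show ((k + r : ℕ) : ℤ) + r = (k + 2 * r : ℕ) by push_cast; ring, pochWeight,
      show (k + r) ^ 2 = k ^ 2 + 2 * k * r + r * r by ring, pow_add q (k ^ 2 + 2 * k * r),
      ← Nat.cast_mul, zpow_natCast]
    have := pow_ne_zero (r * r) hq0
    field_simp
  · intro n hn
    rw [Finset.mem_range] at hn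
    simp [recipQPoch_of_neg (q ^ 2) (show (n : ℤ) - r < 0 by omega)]

lemma tendsto_qGaussSum {q : ℂ} (hq0 : q ≠ 0) (hq : ‖q‖ < 1) :
    Tendsto (fun r : ℕ => qGaussSum q r) atTop
      (𝓝 (qPochInf (-q) (q ^ 2) / qPochInf (q ^ 2) (q ^ 2))) := by
  have hQ := norm_sq_lt_one hq
  obtain ⟨A, hA⟩ := exists_bound_qPochN (-q) hQ
  obtain ⟨C, hC⟩ := exists_bound_recipQPoch hQ
  have hA0 : 0 ≤ A := (norm_nonneg _).trans (hA 0)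
  have hC0 : 0 ≤ C := (norm_nonneg _).trans (hC 0)
  have hlim : ∑' k : ℕ, qPochInf (-q) (q ^ 2) * (if k = 0 then 1 else 0) *
      (recipQPoch (q ^ 2) k * (qPochInf (q ^ 2) (q ^ 2))⁻¹) =
      qPochInf (-q) (q ^ 2) / qPochInf (q ^ 2) (q ^ 2) := by
    rw [tsum_eq_single 0 fun k hk => by simp [hk]]
    simp [recipQPoch, qPochN, div_eq_mul_inv]
  simp_rw [qGaussSum_natCast hq0 hq, ← hlim]
  refine tendsto_tsum_of_dominated_convergence (bound := fun k => A * ‖q‖ ^ k * (C * C))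
    (((summable_geometric_of_lt_one (norm_nonneg q) hq).mul_left A).mul_right _) (fun k => ?_)
    (Eventually.of_forall fun r k => ?_)
  · refine Tendsto.mul (Tendsto.mul ?_ ?_) (tendsto_const_nhds.mul ?_)
    · exact (tendsto_qPochN (-q) hQ).comp (tendsto_atTop_mono (fun r => Nat.le_add_left r k) tendsto_id)
    · split_ifs with hk
      · simp [hk]
      · refine (tendsto_pow_atTop_nhds_zero_of_norm_lt_one hq).comp
          (tendsto_atTop_mono (fun r => ?_) tendsto_id)
        have : 1 ≤ k := Nat.one_le_iff_ne_zero.2 hk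
        simp only [id]
        nlinarith
    · exact (tendsto_recipQPoch hQ).comp
        (tendsto_atTop_mono (fun r => show r ≤ k + 2 * r by omega) tendsto_id)
  · rw [norm_mul, norm_mul, norm_mul, norm_pow]
    refine mul_le_mul (mul_le_mul (hA _) (pow_le_pow_of_le_one (norm_nonneg q) hq.le ?_)
      (by positivity) hA0) (mul_le_mul (hC _) (hC _) (norm_nonneg _) hC0) (by positivity)
      (by positivity)
    nlinarith [Nat.le_self_pow two_ne_zero k, Nat.zero_le (2 * k * r)]

theorem qGaussSum_eq {q : ℂ} (hq0 : q ≠ 0) (hq : ‖q‖ < 1) (r : ℤ) :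
    qGaussSum q r = qPochInf (-q) (q ^ 2) / qPochInf (q ^ 2) (q ^ 2) := by
  rw [qGaussSum_eq_zero hq0 hq]
  refine tendsto_nhds_unique ?_ (tendsto_qGaussSum hq0 hq)
  simp_rw [qGaussSum_eq_zero hq0 hq]
  exact tendsto_const_nhds

lemma summable_pow_natAbs {ρ : ℝ} (h0 : 0 ≤ ρ) (h1 : ρ < 1) : Summable fun r : ℤ => ρ ^ r.natAbs :=
  Summable.of_nat_of_neg (by simpa using summable_geometric_of_lt_one h0 h1)
    (by simpa using summable_geometric_of_lt_one h0 h1)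

lemma norm_zpow_mul_add_one_le {q : ℂ} (hq0 : q ≠ 0) (hq : ‖q‖ < 1) (r : ℤ) :
    ‖q ^ (r * (r + 1))‖ ≤ ‖q‖⁻¹ * ‖q‖ ^ r.natAbs := by
  have h0 : 0 < ‖q‖ := norm_pos_iff.2 hq0
  rw [norm_zpow, ← zpow_natCast, ← zpow_neg_one, ← zpow_add₀ h0.ne']
  refine zpow_le_zpow_right_of_le_one₀ h0 hq.le ?_
  rw [Int.natCast_natAbs]
  rcases abs_cases r with ⟨h, _⟩ | ⟨h, _⟩ <;> rw [h] <;> nlinarith [sq_nonneg (r + 1)]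

theorem tsum_pochWeight_mul_tsum {q : ℂ} (hq0 : q ≠ 0) (hq : ‖q‖ < 1) {h : ℤ → ℂ} {K : ℝ}
    (hK : ∀ r, ‖h r‖ ≤ K) :
    ∑' n : ℕ, pochWeight q n * ∑' r : ℤ, fracCoef q n r * h r =
      qPochInf (-q) (q ^ 2) / qPochInf (q ^ 2) (q ^ 2) *
        ∑' r : ℤ, (-1) ^ r * q ^ (r * (2 * r + 1)) * h r := by
  obtain ⟨A, hA0, hA⟩ := exists_bound_pochWeight hq
  obtain ⟨C, hC⟩ := exists_bound_recipQPoch (norm_sq_lt_one hq)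
  have hC0 : 0 ≤ C := (norm_nonneg _).trans (hC 0)
  have hK0 : 0 ≤ K := (norm_nonneg _).trans (hK 0)
  have hf : Summable fun n : ℕ => A * ‖q‖ ^ n :=
    (summable_geometric_of_lt_one (norm_nonneg q) hq).mul_left A
  have hg : Summable fun r : ℤ => ‖q‖⁻¹ * ‖q‖ ^ r.natAbs * (C * C * K) :=
    ((summable_pow_natAbs (norm_nonneg q) hq).mul_left ‖q‖⁻¹).mul_right (C * C * K)
  have hb := hf.mul_of_nonneg hg (fun n => by simp only [Pi.zero_apply]; positivity)
    (fun r => by simp only [Pi.zero_apply]; positivity)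
  have hle : ∀ (n : ℕ) (r : ℤ), ‖pochWeight q n * (fracCoef q n r * h r)‖ ≤
      A * ‖q‖ ^ n * (‖q‖⁻¹ * ‖q‖ ^ r.natAbs * (C * C * K)) := by
    intro n r
    have h1 : ‖fracCoef q n r * h r‖ = ‖q ^ (r * (r + 1))‖ *
        (‖recipQPoch (q ^ 2) (n - r)‖ * ‖recipQPoch (q ^ 2) (n + r)‖ * ‖h r‖) := by
      rw [fracCoef, norm_mul, norm_mul, norm_mul, norm_mul, norm_zpow, norm_neg, norm_one,
        one_zpow]
      ring
    rw [norm_mul, h1]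
    gcongr
    · exact hA n
    · exact norm_zpow_mul_add_one_le hq0 hq r
    · exact hC _
    · exact hC _
    · exact hK r
  have hsum : Summable fun p : ℕ × ℤ => pochWeight q p.1 * (fracCoef q p.1 p.2 * h p.2) :=
    Summable.of_norm_bounded hb fun p => hle p.1 p.2
  calc ∑' n : ℕ, pochWeight q n * ∑' r : ℤ, fracCoef q n r * h r
      = ∑' (n : ℕ) (r : ℤ), pochWeight q n * (fracCoef q n r * h r) :=
        tsum_congr fun n => tsum_mul_left.symm
    _ = ∑' (r : ℤ) (n : ℕ), pochWeight q n * (fracCoef q n r * h r) :=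
        (Summable.tsum_comm (f := fun (n : ℕ) (r : ℤ) => pochWeight q n * (fracCoef q n r * h r))
          hsum).symm
    _ = ∑' r : ℤ, qPochInf (-q) (q ^ 2) / qPochInf (q ^ 2) (q ^ 2) *
          ((-1) ^ r * q ^ (r * (2 * r + 1)) * h r) := tsum_congr fun r => ?_
    _ = _ := tsum_mul_left
  have h1 : q ^ (r * (2 * r + 1)) = q ^ (r * (r + 1)) * q ^ (r * r) := by
    rw [← zpow_add₀ hq0]
    congr 1
    ring
  have h2 : ∀ n : ℕ, pochWeight q n * (fracCoef q n r * h r) =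
      (-1) ^ r * q ^ (r * (r + 1)) * h r * (pochWeight q n *
        (recipQPoch (q ^ 2) (n - r) * recipQPoch (q ^ 2) (n + r))) := by
    intro n
    rw [fracCoef]
    ring
  rw [← qGaussSum_eq hq0 hq r, qGaussSum, tsum_congr h2, tsum_mul_left, h1]
  have h3 := zpow_ne_zero (r * r) hq0
  field_simp

theorem nStarM2_eq {q z : ℂ} (hq0 : q ≠ 0) (hq : ‖q‖ < 1) (hz0 : z ≠ 0) {K : ℝ}
    (hz : ∀ r : ℤ, 1 - z * (q ^ 2) ^ r ≠ 0) (hK : ∀ r : ℤ, ‖(1 - z * (q ^ 2) ^ r)⁻¹‖ ≤ K) :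
    nStarM2 z q = qPochInf (-q) (q ^ 2) / qPochInf (q ^ 2) (q ^ 2) *
      ∑' r : ℤ, (-1) ^ r * q ^ (r * (2 * r + 1)) * (1 - z * (q ^ 2) ^ r)⁻¹ := by
  rw [← tsum_pochWeight_mul_tsum hq0 hq hK, nStarM2, nGenM2, ← tsum_div_const]
  refine tsum_congr fun n => ?_
  rw [tsum_fracCoef_div hq0 hq hz0 hz, pochWeight]
  simp only [div_eq_mul_inv]
  ring

theorem qPochInf_mul_tsum_eq_one {q : ℂ} (hq0 : q ≠ 0) (hq : ‖q‖ < 1) :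
    qPochInf (-q) (q ^ 2) / qPochInf (q ^ 2) (q ^ 2) *
      ∑' r : ℤ, (-1) ^ r * q ^ (r * (2 * r + 1)) = 1 := by
  have h := tsum_pochWeight_mul_tsum hq0 hq (h := 1) (K := 1) (by simp)
  simp only [Pi.one_apply, mul_one] at h
  rw [← h, tsum_eq_single 0 fun n hn => by rw [tsum_fracCoef_eq_zero hq0 hq hn, mul_zero],
    tsum_eq_single 0 fun r hr => by simp [fracCoef_zero, hr]]
  simp [fracCoef_zero, pochWeight, qPochN]

/-- The function `1 / (1 - e^{2πiv})`. -/
def geomInv (v : ℂ) : ℂ := (1 - Complex.exp (2 * π * I * v))⁻¹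

/-- The coefficients `(-1)^n e^{2πi n(2n+1)t}` of the Appell sum. -/
def appellCoef (n : ℤ) (t : ℂ) : ℂ :=
  (-1) ^ n * Complex.exp (2 * π * I * ((n * (2 * n + 1) : ℤ) * t))

lemma two_pi_I_ne : 2 * (π : ℂ) * I ≠ 0 := by simp [Real.pi_ne_zero]

lemma norm_exp_two_pi_I (v : ℂ) : ‖Complex.exp (2 * π * I * v)‖ = Real.exp (-(2 * π * v.im)) := by
  rw [Complex.norm_exp]
  congr 1
  simp [mul_assoc]

lemma exp_ne_one_iff {u τ : ℂ} (n : ℤ) :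
    1 - Complex.exp (2 * π * I * (u + 2 * n * τ)) ≠ 0 ↔ ∀ m : ℤ, u ≠ 2 * (-n : ℤ) * τ + m := by
  rw [ne_eq, sub_eq_zero, eq_comm, Complex.exp_eq_one_iff, not_exists]
  refine forall_congr' fun m => not_congr ?_
  rw [mul_comm (m : ℂ), mul_right_inj' two_pi_I_ne]
  push_cast
  constructor <;> intro h <;> linear_combination h

lemma hasDerivAt_geomInv {v : ℂ} (hv : 1 - Complex.exp (2 * π * I * v) ≠ 0) :
    HasDerivAt geomInv (2 * π * I * (geomInv v ^ 2 - geomInv v)) v := by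
  have h1 : HasDerivAt (fun v : ℂ => 1 - Complex.exp (2 * π * I * v))
      (-(Complex.exp (2 * π * I * v) * (2 * π * I))) v := by
    simpa using (((hasDerivAt_id v).const_mul (2 * π * I)).cexp).const_sub 1
  have h2 : HasDerivAt (fun v : ℂ => (1 - Complex.exp (2 * π * I * v))⁻¹) _ v := h1.fun_inv hv
  refine h2.congr_deriv ?_
  simp only [geomInv]
  field_simp
  ring

lemma geomInv_add_one (v : ℂ) : geomInv (v + 1) = geomInv v := by
  rw [geomInv, geomInv, mul_add, mul_one, Complex.exp_add, Complex.exp_two_pi_mul_I, mul_one]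

lemma hasDerivAt_appellCoef (n : ℤ) (t : ℂ) :
    HasDerivAt (appellCoef n) (2 * π * I * ((n * (2 * n + 1) : ℤ) * appellCoef n t)) t := by
  have h := ((((hasDerivAt_id t).const_mul ((n * (2 * n + 1) : ℤ) : ℂ)).const_mul
    (2 * π * I)).cexp).const_mul ((-1 : ℂ) ^ n)
  refine (h.congr_deriv ?_ :
    HasDerivAt (fun t => (-1) ^ n * Complex.exp (2 * π * I * ((n * (2 * n + 1) : ℤ) * t))) _ t)
  simp only [appellCoef, id]
  ring

/-- A Gaussian majorant. -/
def gaussMaj (η : ℝ) (n : ℤ) : ℝ := Real.exp (-(2 * π * η * n ^ 2))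

lemma gaussMaj_nonneg (η : ℝ) (n : ℤ) : 0 ≤ gaussMaj η n := (Real.exp_pos _).le

lemma summable_gaussMaj {η : ℝ} (hη : 0 < η) : Summable (gaussMaj η) := by
  refine (summable_pow_mul_jacobiTheta₂_term_bound 0 (show 0 < 2 * η by positivity) 0).congr ?_
  intro n
  simp only [gaussMaj, pow_zero, one_mul]
  congr 1
  ring

lemma summable_sq_mul_gaussMaj {η : ℝ} (hη : 0 < η) :
    Summable fun n : ℤ => gaussMaj η n * (1 + (n : ℝ) ^ 2) := by
  have h := summable_pow_mul_jacobiTheta₂_term_bound 0 (show 0 < 2 * η by positivity) 2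
  refine ((summable_gaussMaj hη).add h).congr fun n => ?_
  have h1 : Real.exp (-π * (2 * η * n ^ 2 - 2 * 0 * |n|)) = gaussMaj η n := by
    rw [gaussMaj]
    congr 1
    ring
  rw [h1, Int.cast_abs, sq_abs]
  ring

lemma norm_appellCoef_le {η : ℝ} {t : ℂ} (hη : 0 < η) (ht : η ≤ t.im) (n : ℤ) :
    ‖appellCoef n t‖ ≤ gaussMaj η n := by
  rw [appellCoef, norm_mul, norm_zpow, norm_neg, norm_one, one_zpow, one_mul, norm_exp_two_pi_I,
    gaussMaj]
  refine Real.exp_le_exp.2 (neg_le_neg ?_)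
  have h1 : (n : ℝ) ^ 2 ≤ ((n * (2 * n + 1) : ℤ) : ℝ) := by
    have : n ^ 2 ≤ n * (2 * n + 1) := by
      rcases le_or_gt 0 n with h | h <;> nlinarith
    exact_mod_cast this
  have h2 : (((n * (2 * n + 1) : ℤ) : ℂ) * t).im = ((n * (2 * n + 1) : ℤ) : ℝ) * t.im := by
    rw [← Complex.ofReal_intCast, Complex.im_ofReal_mul]
  rw [h2]
  have h3 : η * (n : ℝ) ^ 2 ≤ t.im * ((n * (2 * n + 1) : ℤ) : ℝ) :=
    mul_le_mul ht h1 (by positivity) (by linarith)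
  nlinarith [Real.pi_pos]

lemma half_le_norm_one_sub_exp {v : ℂ} (hv : 1 ≤ |v.im|) :
    1 / 2 ≤ ‖1 - Complex.exp (2 * π * I * v)‖ := by
  have hexp : 2 ≤ Real.exp (2 * π) := by
    have := Real.add_one_le_exp (2 * π)
    have := Real.pi_gt_three
    linarith
  rcases le_abs.1 hv with h | h
  · have h1 : ‖Complex.exp (2 * π * I * v)‖ ≤ 1 / 2 := by
      rw [norm_exp_two_pi_I]
      have : Real.exp (-(2 * π * v.im)) ≤ Real.exp (-(2 * π)) :=
        Real.exp_le_exp.2 (by nlinarith [Real.pi_pos])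
      rw [Real.exp_neg (2 * π)] at this
      refine this.trans ?_
      rw [one_div]
      gcongr
    have h2 := norm_sub_norm_le (1 : ℂ) (Complex.exp (2 * π * I * v))
    rw [norm_one] at h2
    linarith
  · have h1 : 2 ≤ ‖Complex.exp (2 * π * I * v)‖ := by
      rw [norm_exp_two_pi_I]
      exact hexp.trans (Real.exp_le_exp.2 (by nlinarith [Real.pi_pos]))
    have h2 := norm_sub_norm_le (Complex.exp (2 * π * I * v)) (1 : ℂ)
    rw [norm_one, norm_sub_rev] at h2
    linarith

lemma exists_lower_bound {s : Set ℤ} {u τ : ℂ} (hτ : 0 < τ.im)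
    (h : ∀ n ∈ s, 1 - Complex.exp (2 * π * I * (u + 2 * n * τ)) ≠ 0) :
    ∃ δ > 0, ∀ᶠ p : ℂ × ℂ in 𝓝 (u, τ), ∀ n ∈ s,
      δ ≤ ‖1 - Complex.exp (2 * π * I * (p.1 + 2 * n * p.2))‖ := by
  have hloc : ∀ n : ℤ, ∃ δ : {x : ℝ // 0 < x}, n ∈ s → ∀ᶠ p : ℂ × ℂ in 𝓝 (u, τ),
      δ.1 ≤ ‖1 - Complex.exp (2 * π * I * (p.1 + 2 * n * p.2))‖ := by
    intro n
    by_cases hn : n ∈ s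
    · have hpos := norm_pos_iff.2 (h n hn)
      refine ⟨⟨_, half_pos hpos⟩, fun _ => ?_⟩
      have hc : ContinuousAt (fun p : ℂ × ℂ =>
          ‖1 - Complex.exp (2 * π * I * (p.1 + 2 * n * p.2))‖) (u, τ) := by fun_prop
      filter_upwards [hc.eventually (lt_mem_nhds (half_lt_self hpos))] with p hp using hp.le
    · exact ⟨⟨1, one_pos⟩, fun h => absurd h hn⟩
  choose δ hδ using hloc
  set M : ℝ := |u.im| + 1 with hM
  obtain ⟨N, hN⟩ := exists_nat_gt ((M + 1) / τ.im)
  rw [div_lt_iff₀ hτ] at hN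
  have hne : (Finset.Icc (-N : ℤ) N).Nonempty := ⟨0, by simp⟩
  refine ⟨min ((Finset.Icc (-N : ℤ) N).inf' hne fun n => (δ n).1) (1 / 2),
    lt_min ((Finset.lt_inf'_iff hne).2 fun n _ => (δ n).2) (by norm_num), ?_⟩
  have h1 : ∀ᶠ p : ℂ × ℂ in 𝓝 (u, τ), τ.im / 2 < p.2.im :=
    (show ContinuousAt (fun p : ℂ × ℂ => p.2.im) (u, τ) by fun_prop).eventually
      (lt_mem_nhds (half_lt_self hτ))
  have h2 : ∀ᶠ p : ℂ × ℂ in 𝓝 (u, τ), |p.1.im| < M :=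
    (show ContinuousAt (fun p : ℂ × ℂ => |p.1.im|) (u, τ) by fun_prop).eventually
      (gt_mem_nhds (by simp [hM]))
  have h3 : ∀ᶠ p : ℂ × ℂ in 𝓝 (u, τ), ∀ n ∈ Finset.Icc (-N : ℤ) N, n ∈ s →
      (δ n).1 ≤ ‖1 - Complex.exp (2 * π * I * (p.1 + 2 * n * p.2))‖ := by
    rw [eventually_all_finset]
    intro n _
    by_cases hn : n ∈ s
    · filter_upwards [hδ n hn] with p hp _ using hp
    · exact Eventually.of_forall fun p h => absurd h hn
  filter_upwards [h1, h2, h3] with p hp1 hp2 hp3 n hn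
  by_cases hmem : n ∈ Finset.Icc (-N : ℤ) N
  · exact (min_le_left _ _).trans ((Finset.inf'_le _ hmem).trans (hp3 n hmem hn))
  · refine (min_le_right _ _).trans (half_le_norm_one_sub_exp ?_)
    have him : (p.1 + 2 * n * p.2).im = p.1.im + 2 * n * p.2.im := by
      simp
    rw [him, le_abs]
    rw [Finset.mem_Icc, not_and_or, not_le, not_le] at hmem
    have ⟨hp3, hp4⟩ := abs_lt.1 hp2
    rcases hmem with hmem | hmem
    · right
      have : (n : ℝ) ≤ -N := by exact_mod_cast hmem.le
      have hN0 : (0 : ℝ) ≤ N := Nat.cast_nonneg N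
      nlinarith
    · left
      have : (N : ℝ) ≤ n := by exact_mod_cast hmem.le
      have hN0 : (0 : ℝ) ≤ N := Nat.cast_nonneg N
      nlinarith

lemma norm_geomInv_le {v : ℂ} {δ : ℝ} (hδ : 0 < δ)
    (h : δ ≤ ‖1 - Complex.exp (2 * π * I * v)‖) : ‖geomInv v‖ ≤ δ⁻¹ := by
  rw [geomInv, norm_inv]
  exact inv_anti₀ hδ h

lemma one_sub_exp_ne_zero_of_le {v : ℂ} {δ : ℝ} (hδ : 0 < δ)
    (h : δ ≤ ‖1 - Complex.exp (2 * π * I * v)‖) : 1 - Complex.exp (2 * π * I * v) ≠ 0 :=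
  norm_pos_iff.1 (hδ.trans_le h)

lemma eventually_hasSum_deriv_tsum {F F' : ℤ → ℂ → ℂ} {M : ℤ → ℝ} (hM : Summable M) {x : ℂ}
    (h : ∀ᶠ w in 𝓝 x, ∀ n, HasDerivAt (F n) (F' n w) w ∧ ‖F n w‖ ≤ M n) :
    ∀ᶠ w in 𝓝 x, (Summable fun n => F n w) ∧ DifferentiableAt ℂ (fun w => ∑' n, F n w) w ∧
      HasSum (fun n => F' n w) (deriv (fun w => ∑' n, F n w) w) := by
  obtain ⟨U, hU, hUo, hxU⟩ := eventually_nhds_iff.1 h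
  filter_upwards [hUo.mem_nhds hxU] with w hw
  have hd : ∀ n, DifferentiableOn ℂ (F n) U := fun n w hw =>
    (hU w hw n).1.differentiableAt.differentiableWithinAt
  have hb : ∀ n w, w ∈ U → ‖F n w‖ ≤ M n := fun n w hw => (hU w hw n).2
  refine ⟨hM.of_norm_bounded fun n => hb n w hw,
    (Complex.differentiableOn_tsum_of_summable_norm hM hd hUo hb).differentiableAt
      (hUo.mem_nhds hw), ?_⟩
  refine (Complex.hasSum_deriv_of_summable_norm hM hd hUo hb hw).congr_fun ?_
  exact fun n => (hU w hw n).1.deriv.symm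

/-- The summand of a generalised Appell sum with cubic polynomials in `geomInv`. -/
def cubicTerm (α β γ : ℤ → ℂ) (τ : ℂ) (n : ℤ) (w : ℂ) : ℂ :=
  appellCoef n τ * (α n * geomInv (w + 2 * n * τ) + β n * geomInv (w + 2 * n * τ) ^ 2 +
    γ n * geomInv (w + 2 * n * τ) ^ 3)

lemma hasDerivAt_geomInv_add {w c : ℂ} (h : 1 - Complex.exp (2 * π * I * (w + c)) ≠ 0) :
    HasDerivAt (fun w => geomInv (w + c)) (2 * π * I * (geomInv (w + c) ^ 2 - geomInv (w + c))) w :=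
  (hasDerivAt_geomInv h).comp_add_const w c

lemma hasDerivAt_cubicTerm {α β γ : ℤ → ℂ} {τ w : ℂ} {n : ℤ}
    (h : 1 - Complex.exp (2 * π * I * (w + 2 * n * τ)) ≠ 0) :
    HasDerivAt (cubicTerm α β γ τ n) (2 * π * I * (appellCoef n τ *
      (α n * (geomInv (w + 2 * n * τ) ^ 2 - geomInv (w + 2 * n * τ)) +
        2 * β n * (geomInv (w + 2 * n * τ) ^ 3 - geomInv (w + 2 * n * τ) ^ 2) +
        3 * γ n * (geomInv (w + 2 * n * τ) ^ 4 - geomInv (w + 2 * n * τ) ^ 3)))) w := by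
  have hy := hasDerivAt_geomInv_add h
  refine (((((hy.const_mul (α n)).fun_add ((hy.fun_pow 2).const_mul (β n))).fun_add
    ((hy.fun_pow 3).const_mul (γ n))).const_mul (appellCoef n τ)).congr_deriv ?_ :
    HasDerivAt (fun w => appellCoef n τ * (α n * geomInv (w + 2 * n * τ) +
      β n * geomInv (w + 2 * n * τ) ^ 2 + γ n * geomInv (w + 2 * n * τ) ^ 3)) _ w)
  push_cast
  ring

lemma eventually_cubicTerm {s : Set ℤ} {u τ : ℂ} (hτ : 0 < τ.im)
    (hs : ∀ n ∈ s, 1 - Complex.exp (2 * π * I * (u + 2 * n * τ)) ≠ 0) {α β γ : ℤ → ℂ} {C : ℝ}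
    (hα : ∀ n : ℤ, ‖α n‖ ≤ C * (1 + (n : ℝ) ^ 2)) (hβ : ∀ n : ℤ, ‖β n‖ ≤ C * (1 + (n : ℝ) ^ 2))
    (hγ : ∀ n : ℤ, ‖γ n‖ ≤ C * (1 + (n : ℝ) ^ 2))
    (h0 : ∀ n ∉ s, α n = 0 ∧ β n = 0 ∧ γ n = 0) :
    ∀ᶠ w in 𝓝 u, (Summable fun n => cubicTerm α β γ τ n w) ∧
      DifferentiableAt ℂ (fun w => ∑' n, cubicTerm α β γ τ n w) w ∧
      HasSum (fun n : ℤ => 2 * π * I * (appellCoef n τ *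
      (α n * (geomInv (w + 2 * n * τ) ^ 2 - geomInv (w + 2 * n * τ)) +
        2 * β n * (geomInv (w + 2 * n * τ) ^ 3 - geomInv (w + 2 * n * τ) ^ 2) +
        3 * γ n * (geomInv (w + 2 * n * τ) ^ 4 - geomInv (w + 2 * n * τ) ^ 3))))
        (deriv (fun w => ∑' n, cubicTerm α β γ τ n w) w) := by
  obtain ⟨δ, hδ, hev⟩ := exists_lower_bound hτ hs
  have hev' : ∀ᶠ w in 𝓝 u, ∀ n ∈ s, δ ≤ ‖1 - Complex.exp (2 * π * I * (w + 2 * n * τ))‖ :=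
    (show ContinuousAt (fun w : ℂ => (w, τ)) u by fun_prop).eventually hev
  have hC : 0 ≤ C := by
    have := (norm_nonneg _).trans (hα 0)
    simpa using this
  have hM : Summable fun n : ℤ => gaussMaj τ.im n * (1 + (n : ℝ) ^ 2) *
      (C * (δ⁻¹ + δ⁻¹ ^ 2 + δ⁻¹ ^ 3)) := (summable_sq_mul_gaussMaj hτ).mul_right _
  refine eventually_hasSum_deriv_tsum hM ?_
  filter_upwards [hev'] with w hw n
  by_cases hn : n ∈ s
  · refine ⟨hasDerivAt_cubicTerm (one_sub_exp_ne_zero_of_le hδ (hw n hn)), ?_⟩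
    have hY := norm_geomInv_le hδ (hw n hn)
    set Y := geomInv (w + 2 * n * τ) with hYdef
    have hδ0 : 0 ≤ δ⁻¹ := inv_nonneg.2 hδ.le
    have hD : (0 : ℝ) ≤ C * (1 + (n : ℝ) ^ 2) := by positivity
    have hk : ∀ (a : ℂ) (k : ℕ), ‖a‖ ≤ C * (1 + (n : ℝ) ^ 2) →
        ‖a * Y ^ k‖ ≤ C * (1 + (n : ℝ) ^ 2) * δ⁻¹ ^ k := fun a k ha => by
      rw [norm_mul, norm_pow]
      gcongr
    have h1 := hk _ 1 (hα n)
    have h2 := hk _ 2 (hβ n)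
    have h3 := hk _ 3 (hγ n)
    rw [pow_one, pow_one] at h1
    have h4 := norm_add₃_le (a := α n * Y) (b := β n * Y ^ 2) (c := γ n * Y ^ 3)
    calc ‖cubicTerm α β γ τ n w‖
        = ‖appellCoef n τ‖ * ‖α n * Y + β n * Y ^ 2 + γ n * Y ^ 3‖ := norm_mul _ _
      _ ≤ gaussMaj τ.im n * (C * (1 + (n : ℝ) ^ 2) * (δ⁻¹ + δ⁻¹ ^ 2 + δ⁻¹ ^ 3)) := by
          gcongr
          · exact gaussMaj_nonneg _ _
          · exact norm_appellCoef_le hτ le_rfl n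
          · linarith
      _ = _ := by ring
  · obtain ⟨ha, hb, hc⟩ := h0 n hn
    have : cubicTerm α β γ τ n = fun _ => 0 := by
      funext w
      simp [cubicTerm, ha, hb, hc]
    rw [this]
    refine ⟨?_, ?_⟩
    · simpa [ha, hb, hc] using hasDerivAt_const w (0 : ℂ)
    · rw [norm_zero]
      have := gaussMaj_nonneg τ.im n
      positivity

/-- The Appell sum. -/
def appellSum (w t : ℂ) : ℂ := ∑' n : ℤ, appellCoef n t * geomInv (w + 2 * n * t)

/-- The theta function normalising the Appell sum. -/
def thetaSum (t : ℂ) : ℂ := ∑' n : ℤ, appellCoef n t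

lemma eventually_half_im_le {τ : ℂ} (hτ : 0 < τ.im) : ∀ᶠ t in 𝓝 τ, τ.im / 2 ≤ t.im :=
  (Complex.continuous_im.continuousAt.eventually (lt_mem_nhds (half_lt_self hτ))).mono
    fun _ h => h.le

lemma thetaSum_deriv {τ : ℂ} (hτ : 0 < τ.im) : Summable (fun n => appellCoef n τ) ∧
    DifferentiableAt ℂ thetaSum τ ∧
    HasSum (fun n : ℤ => 2 * π * I * ((n * (2 * n + 1) : ℤ) * appellCoef n τ))
      (deriv thetaSum τ) := by
  refine (eventually_hasSum_deriv_tsum (F := appellCoef)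
    (F' := fun n t => 2 * π * I * ((n * (2 * n + 1) : ℤ) * appellCoef n t))
    (summable_gaussMaj (half_pos hτ)) ?_).self_of_nhds
  filter_upwards [eventually_half_im_le hτ] with t ht n
  exact ⟨hasDerivAt_appellCoef n t, norm_appellCoef_le (half_pos hτ) ht n⟩

lemma appellSum_deriv_snd {u τ : ℂ} (hτ : 0 < τ.im)
    (hs : ∀ n : ℤ, 1 - Complex.exp (2 * π * I * (u + 2 * n * τ)) ≠ 0) :
    Summable (fun n : ℤ => appellCoef n τ * geomInv (u + 2 * n * τ)) ∧
    DifferentiableAt ℂ (appellSum u) τ ∧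
    HasSum (fun n : ℤ => 2 * π * I * (appellCoef n τ *
      ((n * (2 * n + 1) : ℤ) * geomInv (u + 2 * n * τ) +
        2 * n * (geomInv (u + 2 * n * τ) ^ 2 - geomInv (u + 2 * n * τ)))))
      (deriv (appellSum u) τ) := by
  obtain ⟨δ, hδ, hev⟩ := exists_lower_bound (s := Set.univ) hτ (fun n _ => hs n)
  have hev' : ∀ᶠ t in 𝓝 τ, ∀ n ∈ Set.univ,
      δ ≤ ‖1 - Complex.exp (2 * π * I * (u + 2 * (n : ℤ) * t))‖ :=
    (show ContinuousAt (fun t : ℂ => (u, t)) τ by fun_prop).eventually hev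
  refine (eventually_hasSum_deriv_tsum
    (F := fun n t => appellCoef n t * geomInv (u + 2 * n * t))
    (F' := fun n t => 2 * π * I * (appellCoef n t *
      ((n * (2 * n + 1) : ℤ) * geomInv (u + 2 * n * t) +
        2 * n * (geomInv (u + 2 * n * t) ^ 2 - geomInv (u + 2 * n * t)))))
    ((summable_gaussMaj (half_pos hτ)).mul_right δ⁻¹) ?_).self_of_nhds
  filter_upwards [eventually_half_im_le hτ, hev'] with t ht hw n
  have hn := hw n trivial
  constructor
  · have h1 : HasDerivAt (fun t : ℂ => u + 2 * n * t) (2 * n) t := by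
      simpa using ((hasDerivAt_id t).const_mul (2 * (n : ℂ))).const_add u
    have h2 : HasDerivAt (geomInv ∘ fun t : ℂ => u + 2 * n * t) _ t :=
      (hasDerivAt_geomInv (one_sub_exp_ne_zero_of_le hδ hn)).comp t h1
    refine ((hasDerivAt_appellCoef n t).fun_mul h2).congr_deriv ?_
    simp only [Function.comp_apply]
    ring
  · rw [norm_mul]
    exact mul_le_mul (norm_appellCoef_le (half_pos hτ) ht n) (norm_geomInv_le hδ hn)
      (norm_nonneg _) (gaussMaj_nonneg _ _)

lemma exp_sq_zpow (w t : ℂ) (n : ℤ) : Complex.exp (2 * π * I * w) *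
    (Complex.exp (2 * π * I * t) ^ 2) ^ n = Complex.exp (2 * π * I * (w + 2 * n * t)) := by
  rw [← Complex.exp_nat_mul, ← Complex.exp_int_mul, ← Complex.exp_add]
  congr 1
  push_cast
  ring

lemma appellCoef_eq (n : ℤ) (t : ℂ) :
    appellCoef n t = (-1) ^ n * Complex.exp (2 * π * I * t) ^ (n * (2 * n + 1)) := by
  rw [appellCoef, ← Complex.exp_int_mul]
  congr 2
  ring

lemma norm_exp_lt_one {t : ℂ} (ht : 0 < t.im) : ‖Complex.exp (2 * π * I * t)‖ < 1 := by
  rw [norm_exp_two_pi_I, Real.exp_lt_one_iff]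
  have := mul_pos Real.pi_pos ht
  linarith

lemma thetaSum_ne_zero {t : ℂ} (ht : 0 < t.im) : thetaSum t ≠ 0 := by
  have h := qPochInf_mul_tsum_eq_one (Complex.exp_ne_zero _) (norm_exp_lt_one ht)
  simp only [← appellCoef_eq] at h
  exact right_ne_zero_of_mul_eq_one h

lemma inv_thetaSum {t : ℂ} (ht : 0 < t.im) : (thetaSum t)⁻¹ =
    qPochInf (-Complex.exp (2 * π * I * t)) (Complex.exp (2 * π * I * t) ^ 2) /
      qPochInf (Complex.exp (2 * π * I * t) ^ 2) (Complex.exp (2 * π * I * t) ^ 2) := by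
  have h := qPochInf_mul_tsum_eq_one (Complex.exp_ne_zero _) (norm_exp_lt_one ht)
  simp only [← appellCoef_eq] at h
  exact (eq_inv_of_mul_eq_one_left h).symm

lemma nStarM2_exp {w t : ℂ} (ht : 0 < t.im)
    (hs : ∀ n : ℤ, 1 - Complex.exp (2 * π * I * (w + 2 * n * t)) ≠ 0) :
    nStarM2 (Complex.exp (2 * π * I * w)) (Complex.exp (2 * π * I * t)) =
      (thetaSum t)⁻¹ * appellSum w t := by
  obtain ⟨δ, hδ, hev⟩ := exists_lower_bound (s := Set.univ) ht (fun n _ => hs n)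
  have hb := hev.self_of_nhds
  rw [nStarM2_eq (K := δ⁻¹) (Complex.exp_ne_zero _) (norm_exp_lt_one ht) (Complex.exp_ne_zero _),
    ← inv_thetaSum ht, appellSum]
  · simp only [appellCoef_eq, exp_sq_zpow, geomInv]
  · intro r
    rw [exp_sq_zpow]
    exact hs r
  · intro r
    rw [exp_sq_zpow]
    exact norm_geomInv_le hδ (hb r trivial)

/-- The constant `-2 δ_q Θ / Θ`. -/
def thetaLogDeriv (τ : ℂ) : ℂ := -2 * (2 * π * I)⁻¹ * deriv thetaSum τ / thetaSum τ

lemma hasSum_thetaLogDeriv {τ : ℂ} (hτ : 0 < τ.im) :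
    HasSum (fun n : ℤ => appellCoef n τ * (4 * n ^ 2 + 2 * n + thetaLogDeriv τ)) 0 := by
  obtain ⟨hs, -, hd⟩ := thetaSum_deriv hτ
  have h := (hd.mul_left (2 * (2 * π * I)⁻¹)).add (hs.hasSum.mul_right (thetaLogDeriv τ))
  have h0 : 2 * (2 * π * I)⁻¹ * deriv thetaSum τ + (∑' n, appellCoef n τ) * thetaLogDeriv τ = 0 := by
    change _ + thetaSum τ * _ = 0
    have := thetaSum_ne_zero hτ
    rw [thetaLogDeriv]
    field_simp
    ring
  rw [h0] at h
  refine h.congr_fun fun n => ?_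
  have := two_pi_I_ne
  push_cast
  field_simp
  ring

/-- The image of the Appell sum under the second order operator. -/
def heatSum (τ u : ℂ) : ℂ := ∑' n : ℤ,
  cubicTerm (fun n => 4 * n ^ 2 - 2 * n + thetaLogDeriv τ) (fun n => 4 * n - 2) (fun _ => 2) τ n u

lemma norm_quadratic_le (c : ℂ) : ∃ C : ℝ, (∀ n : ℤ, ‖(4 * n ^ 2 - 2 * n + c : ℂ)‖ ≤
    C * (1 + (n : ℝ) ^ 2)) ∧ (∀ n : ℤ, ‖(4 * n - 2 : ℂ)‖ ≤ C * (1 + (n : ℝ) ^ 2)) ∧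
    ∀ n : ℤ, ‖(2 : ℂ)‖ ≤ C * (1 + (n : ℝ) ^ 2) := by
  refine ⟨6 + ‖c‖, fun n => ?_, fun n => ?_, fun n => ?_⟩
  all_goals
    have hc := norm_nonneg c
    have hn : |(n : ℝ)| ≤ 1 + (n : ℝ) ^ 2 := by
      rw [← sq_abs]; nlinarith [sq_nonneg (|(n : ℝ)| - 1)]
    have hcn := mul_nonneg hc (sq_nonneg (n : ℝ))
    have h1 : ‖(4 * (n : ℂ) ^ 2)‖ = 4 * (n : ℝ) ^ 2 := by simp
    have h2 : ‖(2 * (n : ℂ))‖ = 2 * |(n : ℝ)| := by simp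
    have h3 : ‖(4 * (n : ℂ))‖ = 4 * |(n : ℝ)| := by simp
    have h4 : ‖(2 : ℂ)‖ = 2 := by simp
  · have := norm_add_le (4 * (n : ℂ) ^ 2 - 2 * n) c
    have := norm_sub_le (4 * (n : ℂ) ^ 2) (2 * (n : ℂ))
    linarith [hcn]
  · have := norm_sub_le (4 * (n : ℂ)) 2
    nlinarith
  · rw [h4]
    nlinarith [sq_nonneg (n : ℝ)]

lemma operator_nStarM2 {τ u : ℂ} (hτ : 0 < τ.im)
    (hs : ∀ n : ℤ, 1 - Complex.exp (2 * π * I * (u + 2 * n * τ)) ≠ 0) :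
    2 * ((2 * π * I)⁻¹ *
          deriv (fun t : ℂ =>
            nStarM2 (Complex.exp (2 * π * I * u)) (Complex.exp (2 * π * I * t))) τ)
      + ((2 * π * I)⁻¹ *
          deriv (fun w : ℂ =>
            nStarM2 (Complex.exp (2 * π * I * w)) (Complex.exp (2 * π * I * τ))) u)
      + ((2 * π * I)⁻¹)^2 *
          iteratedDeriv 2 (fun w : ℂ =>
            nStarM2 (Complex.exp (2 * π * I * w)) (Complex.exp (2 * π * I * τ))) u =
    (thetaSum τ)⁻¹ * heatSum τ u := by
  have hΘ := thetaSum_ne_zero hτ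
  have h2 := two_pi_I_ne
  obtain ⟨δ, hδ, hev⟩ := exists_lower_bound (s := Set.univ) hτ (fun n _ => hs n)
  have hevt : ∀ᶠ t in 𝓝 τ, ∀ n ∈ Set.univ,
      δ ≤ ‖1 - Complex.exp (2 * π * I * (u + 2 * (n : ℤ) * t))‖ :=
    (show ContinuousAt (fun t : ℂ => (u, t)) τ by fun_prop).eventually hev
  have hevw : ∀ᶠ w in 𝓝 u, ∀ n ∈ Set.univ,
      δ ≤ ‖1 - Complex.exp (2 * π * I * (w + 2 * (n : ℤ) * τ))‖ :=
    (show ContinuousAt (fun w : ℂ => (w, τ)) u by fun_prop).eventually hev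
  have het : (fun t : ℂ => nStarM2 (Complex.exp (2 * π * I * u)) (Complex.exp (2 * π * I * t)))
      =ᶠ[𝓝 τ] fun t => (thetaSum t)⁻¹ * appellSum u t := by
    filter_upwards [hevt, eventually_half_im_le hτ] with t ht ht'
    exact nStarM2_exp (by linarith) fun n => one_sub_exp_ne_zero_of_le hδ (ht n trivial)
  have hew : (fun w : ℂ => nStarM2 (Complex.exp (2 * π * I * w)) (Complex.exp (2 * π * I * τ)))
      =ᶠ[𝓝 u] fun w => (thetaSum τ)⁻¹ * appellSum w τ := by
    filter_upwards [hevw] with w hw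
    exact nStarM2_exp hτ fun n => one_sub_exp_ne_zero_of_le hδ (hw n trivial)
  obtain ⟨hA, hAd, hAs⟩ := appellSum_deriv_snd hτ hs
  obtain ⟨hT, hTd, hTs⟩ := thetaSum_deriv hτ
  have hone : ∀ n : ℤ, ‖(1 : ℂ)‖ ≤ 1 * (1 + (n : ℝ) ^ 2) := fun n => by
    rw [norm_one]; nlinarith [sq_nonneg (n : ℝ)]
  have hnegone : ∀ n : ℤ, ‖(-1 : ℂ)‖ ≤ 1 * (1 + (n : ℝ) ^ 2) := by simpa using hone
  have hzero : ∀ n : ℤ, ‖(0 : ℂ)‖ ≤ 1 * (1 + (n : ℝ) ^ 2) := fun n => by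
    rw [norm_zero]; positivity
  have hw1 := eventually_cubicTerm (s := Set.univ) (α := fun _ => 1) (β := fun _ => 0)
    (γ := fun _ => 0) hτ (fun n _ => hs n) hone hzero hzero (by simp)
  have hw2 := eventually_cubicTerm (s := Set.univ) (α := fun _ => -1) (β := fun _ => 1)
    (γ := fun _ => 0) hτ (fun n _ => hs n) hnegone hone hzero (by simp)
  have hA1 : (fun w => ∑' n, cubicTerm (fun _ => 1) (fun _ => 0) (fun _ => 0) τ n w) =
      fun w => appellSum w τ := by
    funext w
    simp [cubicTerm, appellSum]
  rw [hA1] at hw1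
  have hderiv : deriv (fun w => appellSum w τ) =ᶠ[𝓝 u] fun w => 2 * π * I *
      ∑' n, cubicTerm (fun _ => -1) (fun _ => 1) (fun _ => 0) τ n w := by
    filter_upwards [hw1] with w hw
    rw [← hw.2.2.tsum_eq, tsum_mul_left]
    congr 2
    funext n
    simp only [cubicTerm]
    ring
  have hd1 : deriv (fun w : ℂ => nStarM2 (Complex.exp (2 * π * I * w))
      (Complex.exp (2 * π * I * τ))) =ᶠ[𝓝 u] fun w => (thetaSum τ)⁻¹ * (2 * π * I *
      ∑' n, cubicTerm (fun _ => -1) (fun _ => 1) (fun _ => 0) τ n w) := by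
    filter_upwards [hew.deriv, hderiv] with w h1 h2
    rw [h1, deriv_const_mul_field, h2]
  have hquot : deriv (fun t => (thetaSum t)⁻¹ * appellSum u t) τ =
      -deriv thetaSum τ / thetaSum τ ^ 2 * appellSum u τ +
        (thetaSum τ)⁻¹ * deriv (appellSum u) τ :=
    ((hTd.hasDerivAt.fun_inv hΘ).fun_mul hAd.hasDerivAt).deriv
  rw [iteratedDeriv_succ, iteratedDeriv_one, hd1.deriv_eq, hd1.self_of_nhds,
    deriv_const_mul_field, deriv_const_mul_field, het.deriv_eq, hquot]
  obtain ⟨hs2, -, hd2⟩ := hw2.self_of_nhds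
  have hsum := (((hAs.mul_left (2 * (2 * π * I)⁻¹)).add
    (hA.hasSum.mul_left (thetaLogDeriv τ))).add hs2.hasSum).add (hd2.mul_left (2 * π * I)⁻¹)
  have hheat : heatSum τ u = _ := (hsum.congr_fun (fun n => ?_)).tsum_eq
  · rw [hheat, thetaLogDeriv]
    change _ = (thetaSum τ)⁻¹ * (_ + _ * appellSum u τ + _ + _)
    field_simp
    ring
  · simp only [cubicTerm]
    push_cast
    field_simp
    ring

/-- `u` lies outside the lattice `2ℤτ + ℤ`. -/
def OffLattice (τ u : ℂ) : Prop := ∀ n : ℤ, 1 - Complex.exp (2 * π * I * (u + 2 * n * τ)) ≠ 0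

lemma exp_two_pi_I_add (a b : ℂ) : Complex.exp (2 * π * I * (a + b)) =
    Complex.exp (2 * π * I * a) * Complex.exp (2 * π * I * b) := by
  rw [mul_add, Complex.exp_add]

lemma exp_two_pi_I_add_one (a : ℂ) :
    Complex.exp (2 * π * I * (a + 1)) = Complex.exp (2 * π * I * a) := by
  rw [exp_two_pi_I_add, mul_one, Complex.exp_two_pi_mul_I, mul_one]

lemma offLattice_add_one {τ u : ℂ} : OffLattice τ (u + 1) ↔ OffLattice τ u := by
  refine forall_congr' fun n => ?_
  rw [add_right_comm, exp_two_pi_I_add_one]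

lemma offLattice_add_two_mul {τ u : ℂ} : OffLattice τ (u + 2 * τ) ↔ OffLattice τ u := by
  constructor <;> intro h n
  · have := h (n - 1)
    rwa [show u + 2 * τ + 2 * ((n - 1 : ℤ) : ℂ) * τ = u + 2 * n * τ by push_cast; ring] at this
  · have := h (n + 1)
    rwa [show u + 2 * ((n + 1 : ℤ) : ℂ) * τ = u + 2 * τ + 2 * n * τ by push_cast; ring] at this

lemma one_sub_exp_ne_zero_of_im {v : ℂ} (hv : v.im ≠ 0) :
    1 - Complex.exp (2 * π * I * v) ≠ 0 := by
  intro h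
  have h1 := norm_exp_two_pi_I v
  rw [← sub_eq_zero.1 h, norm_one, eq_comm, Real.exp_eq_one_iff, neg_eq_zero] at h1
  have := Real.pi_ne_zero
  simp_all

lemma heatSum_add_one (τ u : ℂ) : heatSum τ (u + 1) = heatSum τ u := by
  refine tsum_congr fun n => ?_
  simp only [cubicTerm, add_right_comm u 1, geomInv_add_one]

lemma heatSum_summable {τ u : ℂ} (hτ : 0 < τ.im) (hu : OffLattice τ u) :
    (Summable fun n : ℤ => cubicTerm (fun n => 4 * n ^ 2 - 2 * n + thetaLogDeriv τ)
      (fun n => 4 * n - 2) (fun _ => 2) τ n u) ∧ DifferentiableAt ℂ (heatSum τ) u := by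
  obtain ⟨C, h1, h2, h3⟩ := norm_quadratic_le (thetaLogDeriv τ)
  have h := (eventually_cubicTerm (s := Set.univ) (u := u) hτ (fun n _ => hu n) h1 h2 h3
    (by simp)).self_of_nhds
  exact ⟨h.1, h.2.1⟩

lemma appellCoef_sub_one (n : ℤ) (τ : ℂ) : appellCoef (n - 1) τ =
    -(appellCoef n τ * Complex.exp (2 * π * I * τ) *
      (Complex.exp (2 * π * I * (2 * n * τ)))⁻¹ ^ 2) := by
  have h : Complex.exp (2 * π * I * (((n - 1) * (2 * (n - 1) + 1) : ℤ) * τ)) =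
      Complex.exp (2 * π * I * ((n * (2 * n + 1) : ℤ) * τ)) * Complex.exp (2 * π * I * τ) *
        (Complex.exp (2 * π * I * (2 * n * τ)))⁻¹ ^ 2 := by
    rw [← Complex.exp_neg, ← Complex.exp_nat_mul, ← Complex.exp_add, ← Complex.exp_add]
    congr 1
    push_cast
    ring
  rw [appellCoef, appellCoef, zpow_sub_one₀ (by norm_num), h, inv_neg, inv_one]
  ring

lemma appellCoef_neg (n : ℤ) (τ : ℂ) : appellCoef (-n) τ =
    appellCoef n τ * (Complex.exp (2 * π * I * (2 * n * τ)))⁻¹ := by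
  have h : Complex.exp (2 * π * I * ((-n * (2 * -n + 1) : ℤ) * τ)) =
      Complex.exp (2 * π * I * ((n * (2 * n + 1) : ℤ) * τ)) *
        (Complex.exp (2 * π * I * (2 * n * τ)))⁻¹ := by
    rw [← Complex.exp_neg, ← Complex.exp_add]
    congr 1
    push_cast
    ring
  rw [appellCoef, appellCoef, h, zpow_neg, ← inv_zpow, inv_neg, inv_one]
  ring

lemma cubic_shift_identity (n c B q : ℂ) {Z G : ℂ} (hG : G ≠ 0) (h : 1 - Z * G ≠ 0) :
    -(B * q * G⁻¹ ^ 2) * ((4 * (n - 1) ^ 2 - 2 * (n - 1) + c) * (1 - Z * G)⁻¹ +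
      (4 * (n - 1) - 2) * (1 - Z * G)⁻¹ ^ 2 + 2 * (1 - Z * G)⁻¹ ^ 3) +
      q * Z ^ 2 * (B * ((4 * n ^ 2 - 2 * n + c) * (1 - Z * G)⁻¹ +
        (4 * n - 2) * (1 - Z * G)⁻¹ ^ 2 + 2 * (1 - Z * G)⁻¹ ^ 3)) =
    -(B * q * G⁻¹ ^ 2) * (4 * (n - 1) ^ 2 + 2 * (n - 1) + c) +
      -(q * Z) * (B * G⁻¹ * (4 * (-n) ^ 2 + 2 * -n + c)) := by
  obtain ⟨D, hD⟩ : ∃ D, 1 - Z * G = D := ⟨_, rfl⟩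
  have hZ : Z = (1 - D) / G := by
    rw [← hD]
    field_simp
    ring
  rw [hD] at h ⊢
  rw [hZ]
  field_simp
  ring

lemma heatSum_add_two_mul {τ u : ℂ} (hτ : 0 < τ.im) (hu : OffLattice τ u) :
    heatSum τ (u + 2 * τ) = -(Complex.exp (2 * π * I * τ) * Complex.exp (2 * π * I * u) ^ 2) *
      heatSum τ u := by
  have h1 := (heatSum_summable hτ hu).1.hasSum
  have h2 := (heatSum_summable hτ (offLattice_add_two_mul.2 hu)).1.hasSum
  have h3 := (Equiv.subRight (1 : ℤ)).hasSum_iff.2 h2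
  have h4 := h3.add (h1.mul_left (Complex.exp (2 * π * I * τ) * Complex.exp (2 * π * I * u) ^ 2))
  have h5 := (Equiv.subRight (1 : ℤ)).hasSum_iff.2 (hasSum_thetaLogDeriv hτ)
  have h6 := (Equiv.neg ℤ).hasSum_iff.2 (hasSum_thetaLogDeriv hτ)
  have h7 := h5.add (h6.mul_left (-(Complex.exp (2 * π * I * τ) * Complex.exp (2 * π * I * u))))
  have h8 := h4.unique (h7.congr_fun fun n => ?_)
  · rw [mul_zero, add_zero] at h8
    exact (eq_neg_of_add_eq_zero_left h8).trans (neg_mul _ _).symm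
  · simp only [Function.comp_apply, Equiv.subRight_apply, Equiv.neg_apply, cubicTerm, geomInv]
    have hn := hu n
    rw [show u + 2 * τ + 2 * ((n - 1 : ℤ) : ℂ) * τ = u + 2 * n * τ by push_cast; ring]
    rw [exp_two_pi_I_add] at hn ⊢
    rw [appellCoef_sub_one, appellCoef_neg]
    push_cast
    exact cubic_shift_identity _ _ _ _ (Complex.exp_ne_zero _) hn

lemma offLattice_punctured {τ : ℂ} (hτ : 0 < τ.im) : ∀ᶠ w in 𝓝[≠] (0 : ℂ), OffLattice τ w := by
  obtain ⟨δ, hδ, hev⟩ := exists_lower_bound (s := {0}ᶜ) (u := 0) hτ fun n hn =>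
    one_sub_exp_ne_zero_of_im (by simpa using ⟨hn, hτ.ne'⟩)
  have hev' : ∀ᶠ w in 𝓝 0, ∀ n ∈ ({0}ᶜ : Set ℤ),
      δ ≤ ‖1 - Complex.exp (2 * π * I * (w + 2 * n * τ))‖ :=
    (show ContinuousAt (fun w : ℂ => (w, τ)) 0 by fun_prop).eventually hev
  filter_upwards [eventually_nhdsWithin_of_eventually_nhds hev', self_mem_nhdsWithin,
    eventually_nhdsWithin_of_eventually_nhds (Metric.ball_mem_nhds (0 : ℂ) one_pos)]
    with w hw hw0 hw1 n
  by_cases hn : n = 0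
  · subst hn
    rw [exp_ne_one_iff]
    rintro m rfl
    simp only [neg_zero, Int.cast_zero, mul_zero, zero_mul, zero_add, 
      dist_zero_right, Complex.norm_intCast, Set.mem_compl_iff, Set.mem_singleton_iff,
      Int.cast_eq_zero] at hw0 hw1
    have h1 : |m| < 1 := by exact_mod_cast hw1
    exact hw0 (Int.abs_lt_one_iff.1 h1)
  · exact one_sub_exp_ne_zero_of_le hδ (hw n hn)

lemma heatSum_near_zero {τ : ℂ} (hτ : 0 < τ.im) : ∃ G : ℂ → ℂ, ContinuousAt G 0 ∧
    ∀ᶠ w in 𝓝 0, heatSum τ w =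
      thetaLogDeriv τ * geomInv w - 2 * geomInv w ^ 2 + 2 * geomInv w ^ 3 + G w := by
  obtain ⟨C, h1, h2, h3⟩ := norm_quadratic_le (thetaLogDeriv τ)
  have hle : ∀ {f : ℤ → ℂ}, (∀ n : ℤ, ‖f n‖ ≤ C * (1 + (n : ℝ) ^ 2)) → ∀ n : ℤ,
      ‖if n = 0 then 0 else f n‖ ≤ C * (1 + (n : ℝ) ^ 2) := fun {f} hf n => by
    split_ifs
    · rw [norm_zero]
      exact (norm_nonneg _).trans (hf n)
    · exact hf n
  have hev := eventually_cubicTerm (s := {0}ᶜ) (u := 0) hτ (fun n hn =>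
    one_sub_exp_ne_zero_of_im (by simpa using ⟨hn, hτ.ne'⟩)) (hle h1) (hle h2) (hle h3)
    (by simp +contextual)
  refine ⟨_, hev.self_of_nhds.2.1.continuousAt, hev.mono fun w hw => ?_⟩
  refine HasSum.tsum_eq (((hasSum_ite_eq (0 : ℤ) (thetaLogDeriv τ * geomInv w -
    2 * geomInv w ^ 2 + 2 * geomInv w ^ 3)).add hw.1.hasSum).congr_fun fun n => ?_)
  by_cases hn : n = 0
  · simp [hn, cubicTerm, appellCoef]
    ring
  · simp [hn, cubicTerm]

lemma norm_bounded_of_doubly_periodic {τ : ℂ} (hτ : 0 < τ.im) {V : ℂ → ℂ} (hV : Continuous V)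
    (h1 : Function.Periodic V 1) (h2 : Function.Periodic V (2 * τ)) :
    Bornology.IsBounded (Set.range V) := by
  have hK : IsCompact ((fun p : ℝ × ℝ => V (p.1 + p.2 * (2 * τ))) ''
      (Set.Icc 0 1 ×ˢ Set.Icc 0 1)) :=
    (isCompact_Icc.prod isCompact_Icc).image (by fun_prop)
  refine hK.isBounded.subset ?_
  rintro _ ⟨u, rfl⟩
  set b : ℝ := u.im / (2 * τ.im) with hb
  set a : ℝ := (u - b * (2 * τ)).re with ha
  have hu : u = a + b * (2 * τ) := by
    apply Complex.ext
    · simp [ha]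
    · have : ((a : ℂ) + b * (2 * τ)).im = b * (2 * τ.im) := by simp
      rw [this, hb]
      field_simp
  refine ⟨(Int.fract a, Int.fract b), ⟨⟨Int.fract_nonneg a, (Int.fract_lt_one a).le⟩,
    ⟨Int.fract_nonneg b, (Int.fract_lt_one b).le⟩⟩, ?_⟩
  have e : u = ((Int.fract a : ℝ) + (Int.fract b : ℝ) * (2 * τ)) + (⌊a⌋ : ℤ) * (1 : ℂ) +
      (⌊b⌋ : ℤ) * (2 * τ) := by
    rw [hu, Int.fract, Int.fract]
    push_cast
    ring
  conv_rhs => rw [e, h2.int_mul ⌊b⌋, h1.int_mul ⌊a⌋]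

lemma eq_zero_of_antiperiodic {τ : ℂ} (hτ : 0 < τ.im) {W : ℂ → ℂ}
    (h1 : ∀ u, OffLattice τ u → W (u + 1) = -W u)
    (h2 : ∀ u, OffLattice τ u → W (u + 2 * τ) = -W u)
    (hd : ∀ u, OffLattice τ u → DifferentiableAt ℂ W u) {l : ℂ}
    (hl : Tendsto W (𝓝[≠] 0) (𝓝 l)) {u : ℂ} (hu : OffLattice τ u) : W u = 0 := by
  classical
  set V : ℂ → ℂ := fun u => if OffLattice τ u then W u ^ 2 else l ^ 2 with hV
  have hp1 : Function.Periodic V 1 := fun u => by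
    by_cases h : OffLattice τ u
    · simp [hV, offLattice_add_one, h, h1]
    · simp [hV, offLattice_add_one, h]
  have hp2 : Function.Periodic V (2 * τ) := fun u => by
    by_cases h : OffLattice τ u
    · simp [hV, offLattice_add_two_mul, h, h2]
    · simp [hV, offLattice_add_two_mul, h]
  have hopen : ∀ u, OffLattice τ u → ∀ᶠ w in 𝓝 u, OffLattice τ w := fun u hu => by
    obtain ⟨δ, hδ, hev⟩ := exists_lower_bound (s := Set.univ) hτ fun n _ => hu n
    have hev' : ∀ᶠ w in 𝓝 u, ∀ n ∈ Set.univ,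
        δ ≤ ‖1 - Complex.exp (2 * π * I * (w + 2 * (n : ℤ) * τ))‖ :=
      (show ContinuousAt (fun w : ℂ => (w, τ)) u by fun_prop).eventually hev
    exact hev'.mono fun w hw n => one_sub_exp_ne_zero_of_le hδ (hw n trivial)
  have hVd : ∀ u, OffLattice τ u → DifferentiableAt ℂ V u := fun u hu =>
    ((hd u hu).fun_pow 2).congr_of_eventuallyEq ((hopen u hu).mono fun w hw => by simp [hV, hw])
  have h0 : ¬ OffLattice τ 0 := fun h => by simpa using h 0
  have hV0 : DifferentiableAt ℂ V 0 := by
    refine (Complex.analyticAt_of_differentiable_on_punctured_nhds_of_continuousAt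
      ((offLattice_punctured hτ).mono hVd) ?_).differentiableAt
    rw [continuousAt_iff_punctured_nhds]
    have : V 0 = l ^ 2 := by simp [hV, h0]
    rw [this]
    refine (hl.pow 2).congr' ((offLattice_punctured hτ).mono fun w hw => ?_)
    simp [hV, hw]
  have hVdiff : Differentiable ℂ V := fun u => by
    by_cases hu : OffLattice τ u
    · exact hVd u hu
    · simp only [OffLattice, exp_ne_one_iff] at hu
      push Not at hu
      obtain ⟨n, m, hu⟩ := hu
      have hper : V = fun w => V (w + -u) := by
        funext w
        rw [hu, show w + -(2 * ((-n : ℤ) : ℂ) * τ + m) =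
          w + (n : ℤ) * (2 * τ) + ((-m : ℤ) : ℂ) * 1 by push_cast; ring, hp1.int_mul,
          hp2.int_mul]
      rw [hper]
      have hV0' : DifferentiableAt ℂ V (u + -u) := by rwa [add_neg_cancel]
      exact (hV0'.hasDerivAt.comp_add_const u (-u)).differentiableAt
  have hconst := hVdiff.apply_eq_apply_of_bounded
    (norm_bounded_of_doubly_periodic hτ hVdiff.continuous hp1 hp2)
  have hline : ∀ s : ℝ, OffLattice τ (τ + s) := fun s n => by
    refine one_sub_exp_ne_zero_of_im ?_
    have : (τ + s + 2 * n * τ).im = ((2 * n + 1 : ℤ) : ℝ) * τ.im := by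
      simp
      ring
    rw [this]
    exact mul_ne_zero (by exact_mod_cast (by omega)) hτ.ne'
  have hsq : ∀ s : ℝ, W (τ + s) ^ 2 = W u ^ 2 := fun s => by
    simpa [hV, hline s, hu] using hconst (τ + s) u
  by_contra hne
  have hcont : Continuous fun s : ℝ => W (τ + s) := continuous_iff_continuousAt.2 fun s =>
    ContinuousAt.comp (f := fun s : ℝ => τ + (s : ℂ)) (hd _ (hline s)).continuousAt
      (by fun_prop)
  have hanti : W (τ + (1 : ℝ)) = -W (τ + (0 : ℝ)) := by
    simpa using h1 _ (hline 0)
  have hz : W (τ + (0 : ℝ)) ≠ 0 := fun h => by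
    have := hsq 0
    rw [h] at this
    exact hne (by simpa using this.symm)
  rcases isPreconnected_univ.eq_or_eq_neg_of_sq_eq (f := fun s : ℝ => W (τ + s))
    (g := fun _ : ℝ => W u) hcont.continuousOn continuousOn_const (fun s _ => hsq s)
    (fun _ => hne) with h | h
  all_goals
    have ha := h (Set.mem_univ 0)
    have hb := h (Set.mem_univ 1)
    simp only [Pi.neg_apply] at ha hb
    rw [hanti, ha] at hb
    rw [ha] at hz
    exact hz (self_eq_neg.1 hb.symm)

lemma crankStar_eq {z Q : ℂ} (hQ : ‖Q‖ < 1) (h1 : ∀ j : ℕ, 1 - z * Q ^ j ≠ 0)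
    (h2 : ∀ j : ℕ, 1 - z⁻¹ * Q * Q ^ j ≠ 0) :
    crankStar z Q = qPochInf Q Q / (qPochInf z Q * qPochInf (z⁻¹ * Q) Q) := by
  have h1' : ∀ j : ℕ, 1 - z * Q * Q ^ j ≠ 0 := fun j => by
    have := h1 (j + 1)
    rwa [pow_succ', ← mul_assoc] at this
  have e := ((multipliable_qPochInf Q hQ).hasProd.div₀ ((multipliable_qPochInf (z * Q) hQ).hasProd.mul
    (multipliable_qPochInf (z⁻¹ * Q) hQ).hasProd)
    (mul_ne_zero (qPochInf_ne_zero hQ h1') (qPochInf_ne_zero hQ h2))).tprod_eq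
  change _ = qPochInf Q Q / (qPochInf (z * Q) Q * qPochInf (z⁻¹ * Q) Q) at e
  rw [qPochInf_eq_mul z hQ, crankStar, mul_assoc, ← div_div, div_right_comm, ← e, div_eq_inv_mul]
  congr 1
  refine tprod_congr fun n => ?_
  simp only [pow_succ', mul_assoc]

/-- The theta product `(z;q²)_∞ (q²/z;q²)_∞` as a function of `u`. -/
def thetaProd (τ u : ℂ) : ℂ :=
  qPochInf (Complex.exp (2 * π * I * u)) (Complex.exp (2 * π * I * τ) ^ 2) *
    qPochInf ((Complex.exp (2 * π * I * u))⁻¹ * Complex.exp (2 * π * I * τ) ^ 2)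
      (Complex.exp (2 * π * I * τ) ^ 2)

/-- The theta product `(zq²;q²)_∞ (q²/z;q²)_∞` as a function of `u`. -/
def thetaProdReg (τ u : ℂ) : ℂ :=
  qPochInf (Complex.exp (2 * π * I * u) * Complex.exp (2 * π * I * τ) ^ 2)
      (Complex.exp (2 * π * I * τ) ^ 2) *
    qPochInf ((Complex.exp (2 * π * I * u))⁻¹ * Complex.exp (2 * π * I * τ) ^ 2)
      (Complex.exp (2 * π * I * τ) ^ 2)

/-- The theta product `(-zq;q²)_∞ (-q/z;q²)_∞` as a function of `u`. -/
def oddThetaProd (τ u : ℂ) : ℂ :=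
  qPochInf (-(Complex.exp (2 * π * I * u) * Complex.exp (2 * π * I * τ)))
      (Complex.exp (2 * π * I * τ) ^ 2) *
    qPochInf (-((Complex.exp (2 * π * I * u))⁻¹ * Complex.exp (2 * π * I * τ)))
      (Complex.exp (2 * π * I * τ) ^ 2)

lemma thetaProd_eq {τ : ℂ} (hτ : 0 < τ.im) (u : ℂ) :
    thetaProd τ u = (1 - Complex.exp (2 * π * I * u)) * thetaProdReg τ u := by
  rw [thetaProd, thetaProdReg, qPochInf_eq_mul _ (norm_sq_lt_one (norm_exp_lt_one hτ)), mul_assoc]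

lemma exp_two_pi_I_two_mul (τ : ℂ) :
    Complex.exp (2 * π * I * (2 * τ)) = Complex.exp (2 * π * I * τ) ^ 2 := by
  rw [← Complex.exp_nat_mul]
  congr 1
  push_cast
  ring

lemma thetaProd_add_two_mul {τ : ℂ} (hτ : 0 < τ.im) (u : ℂ) :
    thetaProd τ (u + 2 * τ) = -(Complex.exp (2 * π * I * u))⁻¹ * thetaProd τ u := by
  have hQ := norm_sq_lt_one (norm_exp_lt_one hτ)
  rw [thetaProd_eq hτ u, thetaProdReg, thetaProd, exp_two_pi_I_add, exp_two_pi_I_two_mul]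
  have hz := Complex.exp_ne_zero (2 * π * I * u)
  have hq := Complex.exp_ne_zero (2 * π * I * τ)
  generalize Complex.exp (2 * π * I * u) = z at *
  generalize Complex.exp (2 * π * I * τ) = q at *
  rw [show (z * q ^ 2)⁻¹ * q ^ 2 = z⁻¹ by field_simp, qPochInf_eq_mul z⁻¹ hQ]
  field_simp
  ring

lemma oddThetaProd_add_two_mul {τ : ℂ} (hτ : 0 < τ.im) (u : ℂ) :
    oddThetaProd τ (u + 2 * τ) =
      (Complex.exp (2 * π * I * u) * Complex.exp (2 * π * I * τ))⁻¹ * oddThetaProd τ u := by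
  have hQ := norm_sq_lt_one (norm_exp_lt_one hτ)
  rw [oddThetaProd, oddThetaProd, exp_two_pi_I_add, exp_two_pi_I_two_mul]
  have hz := Complex.exp_ne_zero (2 * π * I * u)
  have hq := Complex.exp_ne_zero (2 * π * I * τ)
  generalize Complex.exp (2 * π * I * u) = z at *
  generalize Complex.exp (2 * π * I * τ) = q at *
  rw [qPochInf_eq_mul (-((z * q ^ 2)⁻¹ * q)) hQ, qPochInf_eq_mul (-(z * q)) hQ,
    show -((z * q ^ 2)⁻¹ * q) * q ^ 2 = -(z⁻¹ * q) by field_simp,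
    show -(z * q ^ 2 * q) = -(z * q) * q ^ 2 by ring]
  field_simp
  ring

lemma one_sub_mul_ne_zero {τ u : ℂ} (hu : OffLattice τ u) (j : ℕ) :
    1 - Complex.exp (2 * π * I * u) * (Complex.exp (2 * π * I * τ) ^ 2) ^ j ≠ 0 := by
  have := hu j
  rwa [← exp_sq_zpow, zpow_natCast] at this

lemma one_sub_inv_mul_ne_zero {τ u : ℂ} (hu : OffLattice τ u) (j : ℕ) :
    1 - (Complex.exp (2 * π * I * u))⁻¹ * Complex.exp (2 * π * I * τ) ^ 2 *
      (Complex.exp (2 * π * I * τ) ^ 2) ^ j ≠ 0 := by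
  have h := hu (-(j + 1 : ℕ))
  rw [← exp_sq_zpow, zpow_neg, zpow_natCast, pow_succ'] at h
  have hz := Complex.exp_ne_zero (2 * π * I * u)
  have hq := Complex.exp_ne_zero (2 * π * I * τ)
  generalize Complex.exp (2 * π * I * u) = z at *
  generalize Complex.exp (2 * π * I * τ) = q at *
  contrapose! h
  have h1 : z = q ^ 2 * (q ^ 2) ^ j := by
    field_simp at h
    linear_combination h
  rw [← h1, mul_inv_cancel₀ hz, sub_self]

lemma thetaProd_ne_zero {τ u : ℂ} (hτ : 0 < τ.im) (hu : OffLattice τ u) : thetaProd τ u ≠ 0 :=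
  have hQ := norm_sq_lt_one (norm_exp_lt_one hτ)
  mul_ne_zero (qPochInf_ne_zero hQ (one_sub_mul_ne_zero hu))
    (qPochInf_ne_zero hQ (one_sub_inv_mul_ne_zero hu))

lemma differentiable_exp_two_pi_I : Differentiable ℂ fun u => Complex.exp (2 * π * I * u) := by
  fun_prop

lemma differentiable_inv_exp_two_pi_I :
    Differentiable ℂ fun u => (Complex.exp (2 * π * I * u))⁻¹ :=
  differentiable_exp_two_pi_I.fun_inv fun _ => Complex.exp_ne_zero _

lemma differentiable_thetaProdReg {τ : ℂ} (hτ : 0 < τ.im) : Differentiable ℂ (thetaProdReg τ) :=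
  have hQ := differentiable_qPochInf (norm_sq_lt_one (norm_exp_lt_one hτ))
  (hQ.comp (differentiable_exp_two_pi_I.mul_const _)).mul
    (hQ.comp (differentiable_inv_exp_two_pi_I.mul_const _))

lemma differentiable_oddThetaProd {τ : ℂ} (hτ : 0 < τ.im) : Differentiable ℂ (oddThetaProd τ) :=
  have hQ := differentiable_qPochInf (norm_sq_lt_one (norm_exp_lt_one hτ))
  (hQ.comp (differentiable_exp_two_pi_I.mul_const _).neg).mul
    (hQ.comp (differentiable_inv_exp_two_pi_I.mul_const _).neg)

lemma differentiable_thetaProd {τ : ℂ} (hτ : 0 < τ.im) : Differentiable ℂ (thetaProd τ) := by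
  rw [funext (thetaProd_eq hτ)]
  exact (differentiable_exp_two_pi_I.const_sub 1).mul (differentiable_thetaProdReg hτ)

/-- The difference of both sides of the heat-type equation, multiplied by `e^{-πiu}` and by the
square of `thetaProd`, with `A = (q²;q²)_∞` and `D = (-q;q²)_∞`. -/
def heatDefect (A D τ u : ℂ) : ℂ :=
  Complex.exp (-(π * I * u)) * thetaProd τ u ^ 2 *
    ((thetaSum τ)⁻¹ * heatSum τ u -
      2 * Complex.exp (2 * π * I * u) * (A ^ 2 / D) * (A / thetaProd τ u) ^ 3 * oddThetaProd τ u)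

lemma heatDefect_add_one (A D τ u : ℂ) : heatDefect A D τ (u + 1) = -heatDefect A D τ u := by
  have h : Complex.exp (-(π * I * (u + 1))) = -Complex.exp (-(π * I * u)) := by
    rw [show -(π * I * (u + 1)) = -(π * I * u) - π * I by ring, Complex.exp_sub_pi_mul_I]
  simp only [heatDefect, heatSum_add_one, thetaProd, oddThetaProd, exp_two_pi_I_add_one, h]
  ring

lemma heatDefect_add_two_mul (A D : ℂ) {τ u : ℂ} (hτ : 0 < τ.im) (hu : OffLattice τ u) :
    heatDefect A D τ (u + 2 * τ) = -heatDefect A D τ u := by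
  have h : Complex.exp (-(π * I * (u + 2 * τ))) =
      Complex.exp (-(π * I * u)) * (Complex.exp (2 * π * I * τ))⁻¹ := by
    rw [← Complex.exp_neg, ← Complex.exp_add]
    congr 1
    ring
  rw [heatDefect, heatDefect, heatSum_add_two_mul hτ hu, thetaProd_add_two_mul hτ,
    oddThetaProd_add_two_mul hτ, h, exp_two_pi_I_add, exp_two_pi_I_two_mul]
  have hz := Complex.exp_ne_zero (2 * π * I * u)
  have hq := Complex.exp_ne_zero (2 * π * I * τ)
  have ht := thetaProd_ne_zero hτ hu
  generalize Complex.exp (2 * π * I * u) = z at *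
  generalize Complex.exp (2 * π * I * τ) = q at *
  simp only [div_eq_mul_inv, mul_inv, inv_neg, inv_inv, mul_pow]
  field_simp
  ring

lemma differentiableAt_heatDefect (A D : ℂ) {τ u : ℂ} (hτ : 0 < τ.im) (hu : OffLattice τ u) :
    DifferentiableAt ℂ (heatDefect A D τ) u := by
  have h1 := (heatSum_summable hτ hu).2
  have h2 := differentiable_thetaProd hτ u
  have h3 := differentiable_oddThetaProd hτ u
  have h4 := thetaProd_ne_zero hτ hu
  unfold heatDefect
  fun_prop (disch := assumption)

lemma tendsto_heatDefect {τ : ℂ} (hτ : 0 < τ.im) : ∃ l, Tendsto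
    (heatDefect (qPochInf (Complex.exp (2 * π * I * τ) ^ 2) (Complex.exp (2 * π * I * τ) ^ 2))
      (qPochInf (-Complex.exp (2 * π * I * τ)) (Complex.exp (2 * π * I * τ) ^ 2)) τ)
      (𝓝[≠] 0) (𝓝 l) := by
  have hq := norm_exp_lt_one hτ
  have hQ := norm_sq_lt_one hq
  have hΘ := inv_thetaSum hτ
  have hΘ0 := inv_ne_zero (thetaSum_ne_zero hτ)
  have hR0 : thetaProdReg τ 0 =
      qPochInf (Complex.exp (2 * π * I * τ) ^ 2) (Complex.exp (2 * π * I * τ) ^ 2) ^ 2 := by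
    simp [thetaProdReg, sq]
  have hP0 : oddThetaProd τ 0 =
      qPochInf (-Complex.exp (2 * π * I * τ)) (Complex.exp (2 * π * I * τ) ^ 2) ^ 2 := by
    simp [oddThetaProd, sq]
  generalize qPochInf (Complex.exp (2 * π * I * τ) ^ 2) (Complex.exp (2 * π * I * τ) ^ 2) = A at *
  generalize qPochInf (-Complex.exp (2 * π * I * τ)) (Complex.exp (2 * π * I * τ) ^ 2) = D at *
  rw [hΘ] at hΘ0
  have hD : D ≠ 0 := fun h => hΘ0 (by rw [h, zero_div])
  have hA : A ≠ 0 := fun h => hΘ0 (by rw [h, div_zero])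
  have hR := differentiable_thetaProdReg hτ
  have hP := differentiable_oddThetaProd hτ
  obtain ⟨G, hG, hheat⟩ := heatSum_near_zero hτ
  set N : ℂ → ℂ := fun w => 2 * (D / A) * thetaProdReg τ w ^ 3 -
    2 * Complex.exp (2 * π * I * w) * (A ^ 5 / D) * oddThetaProd τ w with hN
  set e : ℂ → ℂ := fun w => 1 - Complex.exp (2 * π * I * w) with he
  have hN0 : N 0 = 0 := by
    simp only [hN, hR0, hP0, mul_zero, Complex.exp_zero]
    field_simp
    ring
  have he0 : e 0 = 0 := by simp [he]
  have hNd : DifferentiableAt ℂ N 0 := by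
    have := hR 0
    have := hP 0
    fun_prop
  have hed : HasDerivAt e (-(2 * π * I)) 0 := by
    simpa using (((hasDerivAt_id (0 : ℂ)).const_mul (2 * π * I)).cexp).const_sub 1
  have hquot : Tendsto (fun w => N w / e w) (𝓝[≠] 0) (𝓝 (deriv N 0 / -(2 * π * I))) := by
    refine ((hasDerivAt_iff_tendsto_slope.1 hNd.hasDerivAt).div
      (hasDerivAt_iff_tendsto_slope.1 hed) (neg_ne_zero.2 two_pi_I_ne)).congr' ?_
    filter_upwards [self_mem_nhdsWithin] with w hw
    have hw : w ≠ 0 := hw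
    simp only [slope_def_field, hN0, he0, sub_zero, Pi.div_apply]
    field_simp
  have hRc : ContinuousAt (thetaProdReg τ) 0 := (hR 0).continuousAt
  have hR0' : thetaProdReg τ 0 ≠ 0 := by
    rw [hR0]
    exact pow_ne_zero _ hA
  have hcont : ContinuousAt (fun w => Complex.exp (-(π * I * w)) * ((D / A) * thetaProdReg τ w ^ 2 *
      (thetaLogDeriv τ * e w - 2 + e w ^ 2 * G w))) 0 := by
    have := hed.continuousAt
    fun_prop
  have hcont2 : ContinuousAt (fun w => Complex.exp (-(π * I * w)) * (thetaProdReg τ w)⁻¹) 0 := by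
    fun_prop (disch := assumption)
  refine ⟨_, ((hcont.mono_left nhdsWithin_le_nhds).add
    ((hcont2.mono_left nhdsWithin_le_nhds).mul hquot)).congr' ?_⟩
  filter_upwards [offLattice_punctured hτ, hheat.filter_mono nhdsWithin_le_nhds] with w hw hh
  have ht := thetaProd_ne_zero hτ hw
  rw [thetaProd_eq hτ] at ht
  have h1 := left_ne_zero_of_mul ht
  have h2 := right_ne_zero_of_mul ht
  rw [heatDefect, hh, hΘ, thetaProd_eq hτ, geomInv]
  simp only [hN]
  change e w ≠ 0 at h1
  rw [show 1 - Complex.exp (2 * π * I * w) = e w from rfl]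
  clear_value e N
  field_simp
  ring

/-- The M2-rank for partitions without repeated odd parts: Rank–Crank type PDE. -/
theorem m2_pde (τ u : ℂ) (hτ : 0 < τ.im)
    (hu : ∀ m n : ℤ, u ≠ 2 * (m : ℂ) * τ + (n : ℂ)) :
    2 * Complex.exp (2 * π * I * u) *
        (qPochInf (Complex.exp (2 * π * I * τ) ^ 2) (Complex.exp (2 * π * I * τ) ^ 2) ^ 2 /
          qPochInf (-Complex.exp (2 * π * I * τ)) (Complex.exp (2 * π * I * τ) ^ 2)) *
        crankStar (Complex.exp (2 * π * I * u)) (Complex.exp (2 * π * I * τ) ^ 2) ^ 3 *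
        qPochInf (-(Complex.exp (2 * π * I * u) * Complex.exp (2 * π * I * τ)))
          (Complex.exp (2 * π * I * τ) ^ 2) *
        qPochInf (-((Complex.exp (2 * π * I * u))⁻¹ * Complex.exp (2 * π * I * τ)))
          (Complex.exp (2 * π * I * τ) ^ 2)
    = 2 * ((2 * π * I)⁻¹ *
          deriv (fun t : ℂ =>
            nStarM2 (Complex.exp (2 * π * I * u)) (Complex.exp (2 * π * I * t))) τ)
      + ((2 * π * I)⁻¹ *
          deriv (fun w : ℂ =>
            nStarM2 (Complex.exp (2 * π * I * w)) (Complex.exp (2 * π * I * τ))) u)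
      + ((2 * π * I)⁻¹)^2 *
          iteratedDeriv 2 (fun w : ℂ =>
            nStarM2 (Complex.exp (2 * π * I * w)) (Complex.exp (2 * π * I * τ))) u := by
  have hoff : OffLattice τ u := fun n => (exp_ne_one_iff n).2 (hu (-n))
  have hQ := norm_sq_lt_one (norm_exp_lt_one hτ)
  obtain ⟨l, hl⟩ := tendsto_heatDefect hτ
  have h0 := eq_zero_of_antiperiodic hτ (fun u _ => heatDefect_add_one _ _ τ u)
    (fun u hu => heatDefect_add_two_mul _ _ hτ hu)
    (fun u hu => differentiableAt_heatDefect _ _ hτ hu) hl hoff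
  rw [operator_nStarM2 hτ hoff,
    crankStar_eq hQ (one_sub_mul_ne_zero hoff) (one_sub_inv_mul_ne_zero hoff)]
  have h1 := (mul_eq_zero.1 h0).resolve_left
    (mul_ne_zero (Complex.exp_ne_zero _) (pow_ne_zero 2 (thetaProd_ne_zero hτ hoff)))
  rw [sub_eq_zero, oddThetaProd, ← mul_assoc] at h1
  exact h1.symm

end
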